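/- arXiv:0710.4998 — 5 statements merged into one kernel-verified Lean document; each statement's English description precedes it below -/
import Mathlib

section
/- A nonnegative integer n is represented by the quaternary quadratic form x₁² + 5x₂² + 40y₁² + 160y₂² if and only if n ≡ 0, 1, 4, 5 or 6 (mod 8) and n ≡ 0, 1 or 4 (mod 5). (This is the regularity of the binary Hermitian lattice ⟨1,40⟩ over ℚ(√-5), stated for its associated quadratic form.) -/
/-- The quadratic form `∑ pᵢⱼ (xᵢ - xⱼ)²` with Selling parameters `pᵢⱼ`, `0 ≤ i < j ≤ 3`. -/
def sellingForm (p01 p02 p03 p12 p13 p23 x0 x1 x2 x3 : ℤ) : ℤ :=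
  p01 * (x0 - x1) ^ 2 + p02 * (x0 - x2) ^ 2 + p03 * (x0 - x3) ^ 2 +
    p12 * (x1 - x2) ^ 2 + p13 * (x1 - x3) ^ 2 + p23 * (x2 - x3) ^ 2

/-- The determinant of `sellingForm` on the hyperplane `x0 = 0`, expanded as the sum over the
spanning trees of the complete graph on four vertices. -/
def sellingDet (a b c d e f : ℤ) : ℤ :=
  a * b * c + a * b * e + a * b * f + a * c * d + a * c * f + a * d * e + a * d * f + a * e * f +
    b * c * d + b * c * e + b * d * e + b * d * f + b * e * f + c * d * e + c * d * f + c * e * f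

/-- `n` is a sum of three integer squares. -/
def SumThreeSq (n : ℤ) : Prop := ∃ x y z : ℤ, n = x ^ 2 + y ^ 2 + z ^ 2

theorem le_one_of_sellingDet_eq_one {a b c d e f : ℤ} (hb : 0 ≤ b) (hc : 0 ≤ c)
    (hd : 0 ≤ d) (he : 0 ≤ e) (hf : 0 ≤ f) (hdet : sellingDet a b c d e f = 1) : a ≤ 1 := by
  unfold sellingDet at hdet
  by_contra! ha
  have h1 := mul_nonneg hb hc
  have h2 := mul_nonneg hb he
  have h3 := mul_nonneg hb hf
  have h4 := mul_nonneg hc hd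
  have h5 := mul_nonneg hc hf
  have h6 := mul_nonneg hd he
  have h7 := mul_nonneg hd hf
  have h8 := mul_nonneg he hf
  set P := b * c + b * e + b * f + c * d + c * f + d * e + d * f + e * f with hP
  set R := b * c * d + b * c * e + b * d * e + b * d * f + b * e * f + c * d * e + c * d * f +
    c * e * f with hR
  have hR0 : 0 ≤ R := by positivity
  have hsum : a * P + R = 1 := by rw [← hdet, hP, hR]; ring
  have hP0 : P = 0 := by
    have : 0 ≤ P := by positivity
    nlinarith
  have e1 : b * c = 0 := by linarith
  have e2 : b * e = 0 := by linarith
  have e3 : b * f = 0 := by linarith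
  have e4 : c * d = 0 := by linarith
  have e5 : c * f = 0 := by linarith
  have : R = 0 := by
    linear_combination hR + (d + e) * e1 + (d + f) * e2 + d * e3 + (e + f) * e4 + e * e5
  rw [hP0, this] at hsum
  norm_num at hsum

theorem sumThreeSq_of_reduced {a b c d e f : ℤ} (ha : 0 ≤ a) (hb : 0 ≤ b) (hc : 0 ≤ c)
    (hd : 0 ≤ d) (he : 0 ≤ e) (hf : 0 ≤ f) (hdet : sellingDet a b c d e f = 1)
    (x0 x1 x2 x3 : ℤ) : SumThreeSq (sellingForm a b c d e f x0 x1 x2 x3) := by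
  have h1 := le_one_of_sellingDet_eq_one hb hc hd he hf hdet
  have h2 : b ≤ 1 := le_one_of_sellingDet_eq_one ha hc hd hf he
    (hdet ▸ by unfold sellingDet; ring : sellingDet b a c d f e = 1)
  have h3 : c ≤ 1 := le_one_of_sellingDet_eq_one hb ha hf he hd
    (hdet ▸ by unfold sellingDet; ring : sellingDet c b a f e d = 1)
  have h4 : d ≤ 1 := le_one_of_sellingDet_eq_one hb hf ha he hc
    (hdet ▸ by unfold sellingDet; ring : sellingDet d b f a e c = 1)
  have h5 : e ≤ 1 := le_one_of_sellingDet_eq_one hf hc hd ha hb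
    (hdet ▸ by unfold sellingDet; ring : sellingDet e f c d a b = 1)
  have h6 : f ≤ 1 := le_one_of_sellingDet_eq_one he hc hd hb ha
    (hdet ▸ by unfold sellingDet; ring : sellingDet f e c d b a = 1)
  unfold SumThreeSq sellingForm
  unfold sellingDet at hdet
  interval_cases a <;> interval_cases b <;> interval_cases c <;> interval_cases d <;>
    interval_cases e <;> interval_cases f <;> first
      | (exfalso; revert hdet; norm_num; done)
      | (simp only [zero_mul, one_mul, zero_add, add_zero]; exact ⟨_, _, _, rfl⟩)

/-- A Selling reduction step. -/
theorem sumThreeSq_sellingForm_step {N : ℕ}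
    (ih : ∀ a b c d e f : ℤ, (∀ x y z t, 0 ≤ sellingForm a b c d e f x y z t) →
      sellingDet a b c d e f = 1 → a + b + c + d + e + f < N →
      ∀ x y z t, SumThreeSq (sellingForm a b c d e f x y z t))
    {a b c d e f : ℤ} (hpos : ∀ x y z t, 0 ≤ sellingForm a b c d e f x y z t)
    (hdet : sellingDet a b c d e f = 1) (hN : a + b + c + d + e + f < N + 1) (hd : d < 0)
    (x y z t : ℤ) : SumThreeSq (sellingForm a b c d e f x y z t) := by
  have flip (x y z t : ℤ) : sellingForm (d + e) (d + b) (c - d) (-d) (d + a) (d + f)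
      x (x + t - y) z t = sellingForm a b c d e f x y z t := by
    unfold sellingForm; ring
  rw [← flip]
  refine ih _ _ _ _ _ _ (fun x y z t ↦ ?_) ?_ (by linarith) _ _ _ _
  · have := flip x (x + t - y) z t
    rw [show x + t - (x + t - y) = y by ring] at this
    rw [this]
    exact hpos _ _ _ _
  · rw [← hdet]; unfold sellingDet; ring

/-- A positive ternary form of determinant one represents only sums of three squares. -/
theorem sumThreeSq_sellingForm (N : ℕ) : ∀ a b c d e f : ℤ,
    (∀ x y z t, 0 ≤ sellingForm a b c d e f x y z t) →
      sellingDet a b c d e f = 1 → a + b + c + d + e + f < N →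
      ∀ x y z t, SumThreeSq (sellingForm a b c d e f x y z t) := by
  induction N with
  | zero =>
    intro a b c d e f hpos _ hN
    have h0 := hpos 1 0 0 0
    have h1 := hpos 0 1 0 0
    have h2 := hpos 0 0 1 0
    have h3 := hpos 0 0 0 1
    unfold sellingForm at h0 h1 h2 h3
    push_cast at hN
    linarith
  | succ N ih =>
    intro a b c d e f hpos hdet hN x y z t
    push_cast at hN
    by_cases hd : d < 0
    · exact sumThreeSq_sellingForm_step ih hpos hdet hN hd x y z t
    by_cases ha : a < 0
    · have perm (x y z t : ℤ) : sellingForm d b f a e c z y x t = sellingForm a b c d e f x y z t := by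
        unfold sellingForm; ring
      rw [← perm]
      exact sumThreeSq_sellingForm_step ih (fun x y z t ↦ perm z y x t ▸ hpos z y x t)
        (hdet ▸ by unfold sellingDet; ring) (by linarith) ha _ _ _ _
    by_cases hb : b < 0
    · have perm (x y z t : ℤ) : sellingForm a d e b c f y x z t = sellingForm a b c d e f x y z t := by
        unfold sellingForm; ring
      rw [← perm]
      exact sumThreeSq_sellingForm_step ih (fun x y z t ↦ perm y x z t ▸ hpos y x z t)
        (hdet ▸ by unfold sellingDet; ring) (by linarith) hb _ _ _ _
    by_cases hc : c < 0
    · have perm (x y z t : ℤ) : sellingForm a e d c b f y x t z = sellingForm a b c d e f x y z t := by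
        unfold sellingForm; ring
      rw [← perm]
      exact sumThreeSq_sellingForm_step ih (fun x y z t ↦ perm y x t z ▸ hpos y x t z)
        (hdet ▸ by unfold sellingDet; ring) (by linarith) hc _ _ _ _
    by_cases he : e < 0
    · have perm (x y z t : ℤ) : sellingForm a c b e d f x y t z = sellingForm a b c d e f x y z t := by
        unfold sellingForm; ring
      rw [← perm]
      exact sumThreeSq_sellingForm_step ih (fun x y z t ↦ perm x y t z ▸ hpos x y t z)
        (hdet ▸ by unfold sellingDet; ring) (by linarith) he _ _ _ _
    by_cases hf : f < 0
    · have perm (x y z t : ℤ) : sellingForm c b a f e d x t z y = sellingForm a b c d e f x y z t := by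
        unfold sellingForm; ring
      rw [← perm]
      exact sumThreeSq_sellingForm_step ih (fun x y z t ↦ perm x t z y ▸ hpos x t z y)
        (hdet ▸ by unfold sellingDet; ring) (by linarith) hf _ _ _ _
    exact sumThreeSq_of_reduced (not_lt.1 ha) (not_lt.1 hb) (not_lt.1 hc) (not_lt.1 hd)
      (not_lt.1 he) (not_lt.1 hf) hdet x y z t

theorem sumThreeSq_of_dvd {n d e : ℤ} (hd : 0 < d) (hm : 0 < d * n - 1)
    (h : d * n - 1 ∣ e ^ 2 + d) : SumThreeSq n := by
  obtain ⟨a, ha⟩ := h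
  have key := sumThreeSq_sellingForm
    ((a + e + 1) + (e + (d * n - 1)) + (1 + n) + -e + -1 + 0 + 1).toNat
    (a + e + 1) (e + (d * n - 1)) (1 + n) (-e) (-1) 0 (fun x y z t ↦ ?_) ?_ (by omega) 0 0 0 1
  · simpa [sellingForm] using key
  · refine nonneg_of_mul_nonneg_right (a := (d * n - 1) * d) ?_ (by positivity)
    have : (d * n - 1) * d * sellingForm (a + e + 1) (e + (d * n - 1)) (1 + n) (-e) (-1) 0 x y z t =
        d * (e * (y - x) + (d * n - 1) * (z - x)) ^ 2 + (d * (y - x) + (d * n - 1) * (t - x)) ^ 2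
          + (d * n - 1) * (t - x) ^ 2 := by
      unfold sellingForm
      linear_combination (-d * (y - x) ^ 2) * ha
    rw [this]
    positivity
  · unfold sellingDet
    linear_combination (-n) * ha

theorem exists_dvd_sq_add {p d : ℕ} (hp : p.Prime) (hp4 : p % 4 = 1) (hd : Odd d)
    (h : jacobiSym p d = 1) : ∃ e : ℤ, (p : ℤ) ∣ e ^ 2 + d := by
  have := Fact.mk hp
  have hodd : Odd p := Nat.odd_iff.2 (by omega)
  have h1 : legendreSym p (-d) = 1 := by
    rw [jacobiSym.legendreSym.to_jacobiSym, neg_eq_neg_one_mul, jacobiSym.mul_left,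
      jacobiSym.at_neg_one hodd, ZMod.χ₄_nat_one_mod_four hp4,
      ← jacobiSym.quadratic_reciprocity_one_mod_four hp4 hd, h, one_mul]
  have h0 : ((-d : ℤ) : ZMod p) ≠ 0 := by
    intro h0
    rw [(legendreSym.eq_zero_iff p (-d)).2 h0] at h1
    norm_num at h1
  obtain ⟨r, hr⟩ := (legendreSym.eq_one_iff p h0).1 h1
  obtain ⟨e, rfl⟩ := ZMod.intCast_surjective r
  refine ⟨e, (ZMod.intCast_zmod_eq_zero_iff_dvd _ p).1 ?_⟩
  push_cast at hr ⊢
  rw [sq, ← hr]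
  ring

theorem sumThreeSq_of_mod_four_eq_two {n : ℕ} (hn : n % 4 = 2) : SumThreeSq n := by
  have hcop : (n - 1).Coprime (4 * n) := by
    have h1 : (n - 1).Coprime n := by
      rw [Nat.coprime_self_sub_left (by omega)]; exact Nat.coprime_one_left n
    have h2 : (n - 1).Coprime 4 :=
      Nat.Coprime.pow_right 2 (Nat.coprime_two_right.2 (Nat.odd_iff.2 (by omega)))
    exact Nat.Coprime.mul_right h2 h1
  obtain ⟨p, hpn, hp, hmod⟩ := Nat.forall_exists_prime_gt_and_modEq (4 * n) (by omega) hcop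
  obtain ⟨j, hj⟩ := (Nat.modEq_iff_dvd' (by omega)).1 hmod.symm
  set d := 4 * j + 1 with hd
  have hpd : (p : ℤ) = d * n - 1 := by
    zify [show n - 1 ≤ p by omega, show 1 ≤ n by omega] at hj
    rw [hd]; push_cast
    linear_combination hj
  have hdodd : Odd d := Nat.odd_iff.2 (by omega)
  have hp4 : p % 4 = 1 := by
    obtain ⟨k, rfl⟩ : ∃ k, n = 4 * k + 2 := ⟨n / 4, by omega⟩
    have : p = 4 * ((4 * k + 2) * j) + (4 * k + 2 - 1) := by
      rw [← mul_assoc, ← hj]; omega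
    omega
  have hJ : jacobiSym p d = 1 := by
    rw [hpd, jacobiSym.mod_left, show ((d : ℤ) * n - 1) % d = (-1) % d by
      rw [sub_eq_add_neg, Int.mul_add_emod_self_left], ← jacobiSym.mod_left,
      jacobiSym.at_neg_one hdodd, ZMod.χ₄_nat_one_mod_four (by omega)]
  obtain ⟨e, he⟩ := exists_dvd_sq_add hp hp4 hdodd hJ
  rw [hpd] at he
  exact sumThreeSq_of_dvd (by omega) (hpd ▸ by exact_mod_cast hp.pos) he

theorem sumThreeSq_of_mod_eight_eq_three {n : ℕ} (hn : n % 8 = 3) : SumThreeSq n := by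
  obtain ⟨k, rfl⟩ : ∃ k, n = 8 * k + 3 := ⟨n / 8, by omega⟩
  have hcop : (4 * k + 1).Coprime (4 * (8 * k + 3)) := by
    have h1 : (4 * k + 1).Coprime (8 * k + 3) := by
      rw [show 8 * k + 3 = 1 + (4 * k + 1) * 2 by ring, Nat.coprime_add_mul_left_right]
      exact Nat.coprime_one_right _
    have h2 : (4 * k + 1).Coprime 4 :=
      Nat.Coprime.pow_right 2 (Nat.coprime_two_right.2 (Nat.odd_iff.2 (by omega)))
    exact Nat.Coprime.mul_right h2 h1
  obtain ⟨p, hpn, hp, hmod⟩ :=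
    Nat.forall_exists_prime_gt_and_modEq (4 * (8 * k + 3)) (by omega) hcop
  obtain ⟨j, hj⟩ := (Nat.modEq_iff_dvd' (by omega)).1 hmod.symm
  set d := 8 * j + 1 with hd
  have hpd : (2 * p : ℤ) = d * ((8 * k + 3 : ℕ) : ℤ) - 1 := by
    zify [show 4 * k + 1 ≤ p by omega] at hj
    rw [hd]; push_cast
    linear_combination 2 * hj
  have hdodd : Odd d := Nat.odd_iff.2 (by omega)
  have hp4 : p % 4 = 1 := by
    have : p = 4 * ((8 * k + 3) * j) + (4 * k + 1) := by
      rw [← mul_assoc, ← hj]; omega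
    omega
  have hJ : jacobiSym p d = 1 := by
    have h1 : jacobiSym (-2) d = 1 := by
      rw [jacobiSym.at_neg_two hdodd, ZMod.χ₈'_nat_eq_if_mod_eight,
        if_neg (by omega), if_pos (by omega)]
    have h2 : jacobiSym (-2 * p) d = 1 := by
      rw [neg_mul, hpd, jacobiSym.mod_left,
        show (-((d : ℤ) * ((8 * k + 3 : ℕ) : ℤ) - 1)) % d = 1 % d by
          rw [show -((d : ℤ) * ((8 * k + 3 : ℕ) : ℤ) - 1) = d * (-((8 * k + 3 : ℕ) : ℤ)) + 1 by ring,
            Int.mul_add_emod_self_left], ← jacobiSym.mod_left, jacobiSym.one_left]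
    rwa [jacobiSym.mul_left, h1, one_mul] at h2
  obtain ⟨e, he⟩ := exists_dvd_sq_add hp hp4 hdodd hJ
  have hpodd : Odd (p : ℤ) := by exact_mod_cast Nat.odd_iff.2 (by omega)
  have hdodd' : Odd (d : ℤ) := by exact_mod_cast hdodd
  obtain ⟨e', he', hodd⟩ : ∃ e' : ℤ, (p : ℤ) ∣ e' ^ 2 + d ∧ Odd e' := by
    rcases Int.even_or_odd e with h | h
    · refine ⟨e + p, ?_, h.add_odd hpodd⟩
      rw [show (e + p) ^ 2 + (d : ℤ) = (e ^ 2 + d) + p * (2 * e + p) by ring]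
      exact he.add (dvd_mul_right _ _)
    · exact ⟨e, he, h⟩
  have h2 : (2 : ℤ) ∣ e' ^ 2 + d := (hodd.pow.add_odd hdodd').two_dvd
  have hcop2 : IsCoprime (2 : ℤ) p := by
    obtain ⟨m, hm⟩ := hpodd
    exact ⟨-m, 1, by rw [hm]; ring⟩
  have := hcop2.mul_dvd h2 he'
  rw [hpd] at this
  exact sumThreeSq_of_dvd (by omega) (hpd ▸ by have := hp.pos; positivity) this

/-- `n` is represented by `x₁² + 5x₂² + 40y₁² + 160y₂²`. -/
def Represented (n : ℤ) : Prop :=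
  ∃ x1 x2 y1 y2 : ℤ, x1 ^ 2 + 5 * x2 ^ 2 + 40 * y1 ^ 2 + 160 * y2 ^ 2 = n

theorem represented_of_lt {n : ℕ} (hn : n < 1225)
    (h8 : n % 8 = 0 ∨ n % 8 = 1 ∨ n % 8 = 4 ∨ n % 8 = 5 ∨ n % 8 = 6)
    (h5 : n % 5 = 0 ∨ n % 5 = 1 ∨ n % 5 = 4) : Represented n := by
  have key : ∀ n < 1225,
      (n % 8 = 0 ∨ n % 8 = 1 ∨ n % 8 = 4 ∨ n % 8 = 5 ∨ n % 8 = 6) →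
      (n % 5 = 0 ∨ n % 5 = 1 ∨ n % 5 = 4) → ∃ w < 3, ∃ z < 6, ∃ y < 16,
        Nat.sqrt (n - (5 * y ^ 2 + 40 * z ^ 2 + 160 * w ^ 2)) ^ 2
          + 5 * y ^ 2 + 40 * z ^ 2 + 160 * w ^ 2 = n := by
    decide +kernel
  obtain ⟨w, -, z, -, y, -, h⟩ := key n hn h8 h5
  exact ⟨Nat.sqrt (n - (5 * y ^ 2 + 40 * z ^ 2 + 160 * w ^ 2)), y, z, w, by exact_mod_cast h⟩

/-- Of two odd squares `u²` and `v²`, the sum is `2p² + 8q²` with `p` odd. -/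
theorem exists_eq_two_mul_sq_add_eight_mul_sq {u v : ℤ} (hu : Odd u) (hv : Odd v) :
    ∃ p q : ℤ, u ^ 2 + v ^ 2 = 2 * p ^ 2 + 8 * q ^ 2 ∧ Odd p := by
  obtain ⟨u, rfl⟩ := hu
  obtain ⟨v, rfl⟩ := hv
  rcases Int.even_or_odd (u + v) with ⟨q, hq⟩ | ⟨q, hq⟩
  · refine ⟨2 * q + 1, q - v, ?_, ⟨q, by ring⟩⟩
    obtain rfl : u = 2 * q - v := by linarith
    ring
  · refine ⟨u - v, q + 1, ?_, ⟨q - v, by linarith⟩⟩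
    obtain rfl : u = 2 * q + 1 - v := by linarith
    ring

theorem exists_eq_sq_add_two_mul_sq_add_eight_mul_sq {s : ℤ} (hs0 : 0 ≤ s)
    (hs : s % 4 = 2 ∨ s % 8 = 3) :
    ∃ c p q : ℤ, s = c ^ 2 + 2 * p ^ 2 + 8 * q ^ 2 ∧ Odd p := by
  have h3 : SumThreeSq s := by
    lift s to ℕ using hs0
    rcases hs with hs | hs
    · exact sumThreeSq_of_mod_four_eq_two (by omega)
    · exact sumThreeSq_of_mod_eight_eq_three (by omega)
  have key {c u v : ℤ} (h : s = c ^ 2 + (u ^ 2 + v ^ 2)) (hu : Odd u) (hv : Odd v) :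
      ∃ c p q : ℤ, s = c ^ 2 + 2 * p ^ 2 + 8 * q ^ 2 ∧ Odd p := by
    obtain ⟨p, q, hpq, hp⟩ := exists_eq_two_mul_sq_add_eight_mul_sq hu hv
    exact ⟨c, p, q, by rw [h, hpq]; ring, hp⟩
  have even_or (x : ℤ) : (Even x ∧ x ^ 2 % 4 = 0) ∨ (Odd x ∧ x ^ 2 % 4 = 1) := by
    rcases Int.even_or_odd x with h | h
    · exact .inl ⟨h, by obtain ⟨m, rfl⟩ := h; ring_nf; omega⟩
    · exact .inr ⟨h, by obtain ⟨m, rfl⟩ := h; ring_nf; omega⟩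
  obtain ⟨x, y, z, h⟩ := h3
  rcases even_or x with ⟨-, hx⟩ | ⟨hxo, hx⟩ <;> rcases even_or y with ⟨-, hy⟩ | ⟨hyo, hy⟩ <;>
    rcases even_or z with ⟨-, hz⟩ | ⟨hzo, hz⟩ <;> first
      | (exfalso; omega)
      | exact key (c := z) (by rw [h]; ring) hxo hyo
      | exact key (c := x) (by rw [h]; ring) hyo hzo
      | exact key (c := y) (by rw [h]; ring) hxo hzo

theorem represented_of_eq_sq_add_twenty_mul {n x s : ℤ} (h : n = x ^ 2 + 20 * s) (hs0 : 0 ≤ s)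
    (hs : s % 4 = 2 ∨ s % 8 = 3) : Represented n := by
  obtain ⟨c, p, q, rfl, -⟩ := exists_eq_sq_add_two_mul_sq_add_eight_mul_sq hs0 hs
  exact ⟨x, 2 * c, p, q, by rw [h]; ring⟩

theorem represented_four_mul_of_eq_sq_add_five_mul {n x s : ℤ} (h : n = x ^ 2 + 5 * s)
    (hs0 : 0 ≤ s) (hs : s % 4 = 2) : Represented (4 * n) := by
  obtain ⟨c, p, q, rfl, -⟩ := exists_eq_sq_add_two_mul_sq_add_eight_mul_sq hs0 (.inl hs)
  exact ⟨2 * x, 2 * c, p, q, by rw [h]; ring⟩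

theorem represented_of_eq_sq_add_five_mul {n x s : ℤ} (h : n = x ^ 2 + 5 * s) (hx : x % 8 = 4)
    (hs0 : 0 ≤ s) (hs : s % 8 = 6) : Represented n := by
  obtain ⟨c, p, q, rfl, hp⟩ := exists_eq_sq_add_two_mul_sq_add_eight_mul_sq hs0 (.inl (by omega))
  obtain ⟨a, rfl⟩ : ∃ a, x = 2 * a := ⟨x / 2, by omega⟩
  have hp2 : p ^ 2 % 4 = 1 := by obtain ⟨m, rfl⟩ := hp; ring_nf; omega
  obtain ⟨b, rfl, hb⟩ : ∃ b, c = 2 * b ∧ Odd b := by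
    rcases Int.even_or_odd' c with ⟨b, rfl | rfl⟩
    · refine ⟨b, rfl, ?_⟩
      by_contra hb
      obtain ⟨m, rfl⟩ := Int.not_odd_iff_even.1 hb
      ring_nf at hs
      omega
    · ring_nf at hs
      omega
  -- An isometry of the rational form moves the vector into the lattice once signs are chosen.
  have key {a b : ℤ} (h : n = (2 * a) ^ 2 + 5 * ((2 * b) ^ 2 + 2 * p ^ 2 + 8 * q ^ 2))
      (hm : (p - a - b) % 8 = 0) : Represented n := by
    obtain ⟨m, hm⟩ := Int.dvd_of_emod_eq_zero hm
    obtain rfl : p = a + b + 8 * m := by linarith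
    exact ⟨2 * a - 5 * (a + b + 4 * m), 2 * b - (a + b + 4 * m), q, m, by rw [h]; ring⟩
  obtain ⟨t, rfl⟩ := hp
  obtain ⟨r, rfl⟩ := hb
  have : (2 * t + 1 - a - (2 * r + 1)) % 8 = 0 ∨ (2 * t + 1 - -a - (2 * r + 1)) % 8 = 0 ∨
      (2 * t + 1 - a - -(2 * r + 1)) % 8 = 0 ∨ (2 * t + 1 - -a - -(2 * r + 1)) % 8 = 0 := by omega
  rcases this with hm | hm | hm | hm
  · exact key h hm
  · exact key (by rw [h]; ring) hm
  · exact key (by rw [h]; ring) hm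
  · exact key (by rw [h]; ring) hm

theorem eq_sq_add_of_emod {n x m t : ℕ} (h : (((n % m : ℕ) : ℤ) - (x : ℤ) ^ 2) % m = t) :
    ∃ q : ℤ, (n : ℤ) = (x : ℤ) ^ 2 + (m * q + t) := by
  refine ⟨((n : ℤ) - (x : ℤ) ^ 2) / m, ?_⟩
  rw [Int.natCast_mod, Int.emod_sub_emod] at h
  rw [← h, Int.mul_ediv_add_emod]
  ring

theorem represented_of_mod_eight_of_mod_five (n : ℕ)
    (h8 : n % 8 = 0 ∨ n % 8 = 1 ∨ n % 8 = 4 ∨ n % 8 = 5 ∨ n % 8 = 6)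
    (h5 : n % 5 = 0 ∨ n % 5 = 1 ∨ n % 5 = 4) : Represented n := by
  induction n using Nat.strong_induction_on with
  | _ n ih =>
  rcases lt_or_ge n 1225 with hn | hn
  · exact represented_of_lt hn h8 h5
  have hsq {x : ℕ} (hx : x ≤ 35) : (x : ℤ) ^ 2 ≤ 1225 := by
    exact_mod_cast Nat.pow_le_pow_left hx 2
  have h8 : n % 4 = 0 ∨ n % 8 = 1 ∨ n % 8 = 5 ∨ n % 8 = 6 := by omega
  rcases h8 with h4 | h8 | h8 | h8
  · obtain ⟨k, rfl⟩ : ∃ k, n = 4 * k := ⟨n / 4, by omega⟩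
    have hk5 : k % 5 = 0 ∨ k % 5 = 1 ∨ k % 5 = 4 := by rcases h5 with h | h | h <;> omega
    by_cases hk8 : k % 8 = 0 ∨ k % 8 = 1 ∨ k % 8 = 4 ∨ k % 8 = 5 ∨ k % 8 = 6
    · obtain ⟨a, b, c, d, h⟩ := ih k (by omega) hk8 hk5
      exact ⟨2 * a, 2 * b, 2 * c, 2 * d, by push_cast; rw [← h]; ring⟩
    · have key : ∀ r : ℕ, r < 20 → r % 4 = 2 ∨ r % 4 = 3 → r % 5 = 0 ∨ r % 5 = 1 ∨ r % 5 = 4 →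
          ∃ x : ℕ, x ≤ 5 ∧ ((r : ℤ) - (x : ℤ) ^ 2) % (20 : ℕ) = (10 : ℕ) := by decide +kernel
      obtain ⟨x, hx, hr⟩ := key (k % 20) (Nat.mod_lt _ (by norm_num)) (by omega)
        (by rwa [Nat.mod_mod_of_dvd k (by norm_num : 5 ∣ 20)])
      obtain ⟨q, hq⟩ := eq_sq_add_of_emod hr
      have hx2 : (x : ℤ) ^ 2 ≤ 25 := by exact_mod_cast Nat.pow_le_pow_left hx 2
      push_cast at hq ⊢
      exact represented_four_mul_of_eq_sq_add_five_mul (x := x) (s := 4 * q + 2)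
        (by linarith) (by omega) (by omega)
  · have key : ∀ r : ℕ, r < 80 → r % 8 = 1 → r % 5 = 0 ∨ r % 5 = 1 ∨ r % 5 = 4 →
        ∃ x : ℕ, x ≤ 35 ∧ ((r : ℤ) - (x : ℤ) ^ 2) % (80 : ℕ) = (40 : ℕ) := by decide +kernel
    obtain ⟨x, hx, hr⟩ := key (n % 80) (Nat.mod_lt _ (by norm_num))
      (by rwa [Nat.mod_mod_of_dvd n (by norm_num : 8 ∣ 80)])
      (by rwa [Nat.mod_mod_of_dvd n (by norm_num : 5 ∣ 80)])
    obtain ⟨q, hq⟩ := eq_sq_add_of_emod hr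
    have hx2 := hsq hx
    push_cast at hq
    exact represented_of_eq_sq_add_twenty_mul (x := x) (s := 4 * q + 2)
      (by linarith) (by omega) (by omega)
  · have key : ∀ r : ℕ, r < 160 → r % 8 = 5 → r % 5 = 0 ∨ r % 5 = 1 ∨ r % 5 = 4 →
        ∃ x : ℕ, x ≤ 35 ∧ ((r : ℤ) - (x : ℤ) ^ 2) % (160 : ℕ) = (60 : ℕ) := by decide +kernel
    obtain ⟨x, hx, hr⟩ := key (n % 160) (Nat.mod_lt _ (by norm_num))
      (by rwa [Nat.mod_mod_of_dvd n (by norm_num : 8 ∣ 160)])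
      (by rwa [Nat.mod_mod_of_dvd n (by norm_num : 5 ∣ 160)])
    obtain ⟨q, hq⟩ := eq_sq_add_of_emod hr
    have hx2 := hsq hx
    push_cast at hq
    exact represented_of_eq_sq_add_twenty_mul (x := x) (s := 8 * q + 3)
      (by linarith) (by omega) (by omega)
  · have key : ∀ r : ℕ, r < 40 → r % 8 = 6 → r % 5 = 0 ∨ r % 5 = 1 ∨ r % 5 = 4 →
        ∃ x : ℕ, x ≤ 35 ∧ ((r : ℤ) - (x : ℤ) ^ 2) % (40 : ℕ) = (30 : ℕ) ∧ x % 8 = 4 := by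
      decide +kernel
    obtain ⟨x, hx, hr, hx8⟩ := key (n % 40) (Nat.mod_lt _ (by norm_num))
      (by rwa [Nat.mod_mod_of_dvd n (by norm_num : 8 ∣ 40)])
      (by rwa [Nat.mod_mod_of_dvd n (by norm_num : 5 ∣ 40)])
    obtain ⟨q, hq⟩ := eq_sq_add_of_emod hr
    have hx2 := hsq hx
    push_cast at hq
    exact represented_of_eq_sq_add_five_mul (x := x) (s := 8 * q + 6)
      (by linarith) (by omega) (by omega) (by omega)

theorem stmt_11 (n : ℤ) (hn : 0 ≤ n) :
    (∃ x1 x2 y1 y2 : ℤ, x1^2 + 5*x2^2 + 40*y1^2 + 160*y2^2 = n) ↔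
    ((n % 8 = 0 ∨ n % 8 = 1 ∨ n % 8 = 4 ∨ n % 8 = 5 ∨ n % 8 = 6) ∧ (n % 5 = 0 ∨ n % 5 = 1 ∨ n % 5 = 4)) := by
  constructor
  · rintro ⟨x1, x2, y1, y2, rfl⟩
    have sq8 (x : ℤ) : x ^ 2 % 8 = 0 ∨ x ^ 2 % 8 = 1 ∨ x ^ 2 % 8 = 4 := by
      have : x % 8 = 0 ∨ x % 8 = 1 ∨ x % 8 = 2 ∨ x % 8 = 3 ∨ x % 8 = 4 ∨ x % 8 = 5 ∨
        x % 8 = 6 ∨ x % 8 = 7 := by omega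
      rcases this with h | h | h | h | h | h | h | h <;> simp [sq, Int.mul_emod, h]
    have sq5 : x1 ^ 2 % 5 = 0 ∨ x1 ^ 2 % 5 = 1 ∨ x1 ^ 2 % 5 = 4 := by
      have : x1 % 5 = 0 ∨ x1 % 5 = 1 ∨ x1 % 5 = 2 ∨ x1 % 5 = 3 ∨ x1 % 5 = 4 := by omega
      rcases this with h | h | h | h | h <;> simp [sq, Int.mul_emod, h]
    have h1 := sq8 x1
    have h2 := sq8 x2
    omega
  · rintro ⟨h8, h5⟩
    lift n to ℕ using hn
    exact represented_of_mod_eight_of_mod_five n (by omega) (by omega)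
end

section
/- A nonnegative integer n is represented by the quaternary quadratic form 2x₁² + 2x₁x₂ + 3x₂² + 4y₁² + 20y₂² if and only if n ≡ 0 (mod 2) or n ≡ 3 (mod 4). (This is the regularity of the binary Hermitian lattice [2, −1+ω; −1+ω̄, 3] ⊥ ⟨4⟩ over ℚ(√-5), stated for its associated quadratic form.) -/
/-- Quadruples `(a + b u) + (c + d u) g` with `u ^ 2 = u - 1`, `g ^ 2 = -2` and
`g u = (1 - u) g + 1`. Over `ℤ` this is a maximal order in the definite quaternion algebra
over `ℚ` ramified at `5`. -/
@[ext]
structure QuatOrder (R : Type*) where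
  a : R
  b : R
  c : R
  d : R

namespace QuatOrder

section Ring

variable {R : Type*} [CommRing R]

instance : Zero (QuatOrder R) := ⟨⟨0, 0, 0, 0⟩⟩
instance : One (QuatOrder R) := ⟨⟨1, 0, 0, 0⟩⟩
instance : Add (QuatOrder R) := ⟨fun x y => ⟨x.a + y.a, x.b + y.b, x.c + y.c, x.d + y.d⟩⟩
instance : Neg (QuatOrder R) := ⟨fun x => ⟨-x.a, -x.b, -x.c, -x.d⟩⟩
instance : Mul (QuatOrder R) := ⟨fun x y =>
  ⟨x.a * y.a - x.b * y.b + y.b * x.c - 2 * (x.c * (y.c + y.d) + x.d * y.d),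
   x.a * y.b + x.b * y.a + x.b * y.b + y.b * x.d - 2 * (x.d * y.c - x.c * y.d),
   x.a * y.c - x.b * y.d + x.c * (y.a + y.b) + x.d * y.b + y.d * x.c,
   x.a * y.d + x.b * y.c + x.b * y.d + x.d * y.a - x.c * y.b + y.d * x.d⟩⟩

@[simp] lemma zero_a : (0 : QuatOrder R).a = 0 := rfl
@[simp] lemma zero_b : (0 : QuatOrder R).b = 0 := rfl
@[simp] lemma zero_c : (0 : QuatOrder R).c = 0 := rfl
@[simp] lemma zero_d : (0 : QuatOrder R).d = 0 := rfl
@[simp] lemma one_a : (1 : QuatOrder R).a = 1 := rfl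
@[simp] lemma one_b : (1 : QuatOrder R).b = 0 := rfl
@[simp] lemma one_c : (1 : QuatOrder R).c = 0 := rfl
@[simp] lemma one_d : (1 : QuatOrder R).d = 0 := rfl
@[simp] lemma add_a (x y : QuatOrder R) : (x + y).a = x.a + y.a := rfl
@[simp] lemma add_b (x y : QuatOrder R) : (x + y).b = x.b + y.b := rfl
@[simp] lemma add_c (x y : QuatOrder R) : (x + y).c = x.c + y.c := rfl
@[simp] lemma add_d (x y : QuatOrder R) : (x + y).d = x.d + y.d := rfl
@[simp] lemma neg_a (x : QuatOrder R) : (-x).a = -x.a := rfl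
@[simp] lemma neg_b (x : QuatOrder R) : (-x).b = -x.b := rfl
@[simp] lemma neg_c (x : QuatOrder R) : (-x).c = -x.c := rfl
@[simp] lemma neg_d (x : QuatOrder R) : (-x).d = -x.d := rfl
@[simp] lemma mul_a (x y : QuatOrder R) : (x * y).a =
  x.a * y.a - x.b * y.b + y.b * x.c - 2 * (x.c * (y.c + y.d) + x.d * y.d) := rfl
@[simp] lemma mul_b (x y : QuatOrder R) : (x * y).b =
  x.a * y.b + x.b * y.a + x.b * y.b + y.b * x.d - 2 * (x.d * y.c - x.c * y.d) := rfl
@[simp] lemma mul_c (x y : QuatOrder R) : (x * y).c =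
  x.a * y.c - x.b * y.d + x.c * (y.a + y.b) + x.d * y.b + y.d * x.c := rfl
@[simp] lemma mul_d (x y : QuatOrder R) : (x * y).d =
  x.a * y.d + x.b * y.c + x.b * y.d + x.d * y.a - x.c * y.b + y.d * x.d := rfl

instance : NatCast (QuatOrder R) := ⟨fun n => ⟨n, 0, 0, 0⟩⟩

@[simp] lemma natCast_a (n : ℕ) : (n : QuatOrder R).a = n := rfl
@[simp] lemma natCast_b (n : ℕ) : (n : QuatOrder R).b = 0 := rfl
@[simp] lemma natCast_c (n : ℕ) : (n : QuatOrder R).c = 0 := rfl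
@[simp] lemma natCast_d (n : ℕ) : (n : QuatOrder R).d = 0 := rfl

instance : Ring (QuatOrder R) where
  natCast := Nat.cast
  natCast_zero := by ext <;> simp
  natCast_succ n := by ext <;> simp
  intCast n := ⟨n, 0, 0, 0⟩
  intCast_ofNat n := by ext <;> simp
  intCast_negSucc n := by ext <;> simp [Int.cast_negSucc]
  add_assoc x y z := by ext <;> simp [add_assoc]
  zero_add x := by ext <;> simp
  add_zero x := by ext <;> simp
  add_comm x y := by ext <;> simp [add_comm]
  neg_add_cancel x := by ext <;> simp
  left_distrib x y z := by ext <;> simp <;> ring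
  right_distrib x y z := by ext <;> simp <;> ring
  zero_mul x := by ext <;> simp
  mul_zero x := by ext <;> simp
  mul_assoc x y z := by ext <;> simp <;> ring
  one_mul x := by ext <;> simp
  mul_one x := by ext <;> simp
  nsmul := nsmulRec
  zsmul := zsmulRec

@[simp] lemma intCast_a (n : ℤ) : (n : QuatOrder R).a = n := rfl
@[simp] lemma intCast_b (n : ℤ) : (n : QuatOrder R).b = 0 := rfl
@[simp] lemma intCast_c (n : ℤ) : (n : QuatOrder R).c = 0 := rfl
@[simp] lemma intCast_d (n : ℤ) : (n : QuatOrder R).d = 0 := rfl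
@[simp] lemma sub_a (x y : QuatOrder R) : (x - y).a = x.a - y.a := by simp [sub_eq_add_neg]
@[simp] lemma sub_b (x y : QuatOrder R) : (x - y).b = x.b - y.b := by simp [sub_eq_add_neg]
@[simp] lemma sub_c (x y : QuatOrder R) : (x - y).c = x.c - y.c := by simp [sub_eq_add_neg]
@[simp] lemma sub_d (x y : QuatOrder R) : (x - y).d = x.d - y.d := by simp [sub_eq_add_neg]

/-- The reduced norm. -/
def nrm (x : QuatOrder R) : R :=
  x.a ^ 2 + x.a * x.b + x.b ^ 2 + 2 * (x.c ^ 2 + x.c * x.d + x.d ^ 2) + x.a * x.d - x.b * x.c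

/-- The canonical involution. -/
def conj (x : QuatOrder R) : QuatOrder R := ⟨x.a + x.b + x.d, -x.b, -x.c, -x.d⟩

/-- The sixth root of unity `u`. -/
def unit : QuatOrder R := ⟨0, 1, 0, 0⟩

lemma nrm_mul (x y : QuatOrder R) : nrm (x * y) = nrm x * nrm y := by
  simp only [nrm, mul_a, mul_b, mul_c, mul_d]; ring

lemma nrm_unit : nrm (unit : QuatOrder R) = 1 := by simp [nrm, unit]

lemma nrm_intCast (n : ℤ) : nrm (n : QuatOrder R) = (n : R) ^ 2 := by simp [nrm]

lemma nrm_conj (x : QuatOrder R) : nrm (conj x) = nrm x := by simp only [nrm, conj]; ring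

lemma conj_conj (x : QuatOrder R) : conj (conj x) = x := by
  ext <;> simp only [conj] <;> ring

end Ring

lemma mul_conj (x : QuatOrder ℤ) : x * conj x = (nrm x : ℤ) := by
  ext <;> simp only [mul_a, mul_b, mul_c, mul_d, intCast_a, intCast_b, intCast_c, intCast_d, conj,
    nrm, Int.cast_id] <;> ring

lemma conj_mul (x : QuatOrder ℤ) : conj x * x = (nrm x : ℤ) := by
  ext <;> simp only [mul_a, mul_b, mul_c, mul_d, intCast_a, intCast_b, intCast_c, intCast_d, conj,
    nrm, Int.cast_id] <;> ring

lemma nrm_nonneg (x : QuatOrder ℤ) : 0 ≤ nrm x := by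
  simp only [nrm]
  nlinarith [sq_nonneg (2 * (x.c - x.a - 2 * x.b) + (x.d + 2 * x.a + x.b)),
    sq_nonneg (x.d + 2 * x.a + x.b), sq_nonneg (2 * x.c + x.d), sq_nonneg x.d]

lemma c_eq_zero_and_d_eq_zero {x : QuatOrder ℤ} (h : nrm x ≤ 1) : x.c = 0 ∧ x.d = 0 := by
  simp only [nrm] at h
  have h1 : 5 * (x.c ^ 2 + x.c * x.d + x.d ^ 2) ≤ 3 := by
    nlinarith [sq_nonneg (2 * (x.c - x.a - 2 * x.b) + (x.d + 2 * x.a + x.b)),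
      sq_nonneg (x.d + 2 * x.a + x.b)]
  have h2 : x.c ^ 2 + x.c * x.d + x.d ^ 2 ≤ 0 := by omega
  constructor <;> refine pow_eq_zero_iff (two_ne_zero) |>.1 (le_antisymm ?_ (sq_nonneg _)) <;>
    nlinarith [sq_nonneg (2 * x.c + x.d), sq_nonneg (2 * x.d + x.c)]

lemma eq_zero_of_nrm_eq_zero {x : QuatOrder ℤ} (h : nrm x = 0) : x = 0 := by
  obtain ⟨hc, hd⟩ := c_eq_zero_and_d_eq_zero (h.le.trans zero_le_one)
  simp only [nrm, hc, hd] at h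
  have ha : x.a = 0 := pow_eq_zero_iff (two_ne_zero) |>.1
    (le_antisymm (by nlinarith [sq_nonneg (2 * x.b + x.a)]) (sq_nonneg _))
  have hb : x.b = 0 := by simpa [ha] using h
  ext <;> simp [ha, hb, hc, hd]

/-- In a fundamental triangle of the hexagonal lattice some vertex is near. -/
lemma hexagonal_triangle {r s n : ℤ} (hn : 0 < n) (hr : 0 ≤ r) (hs : 0 ≤ s) (h : r + s ≤ n) :
    3 * (r ^ 2 + r * s + s ^ 2) ≤ n ^ 2 ∨ 3 * ((r - n) ^ 2 + (r - n) * s + s ^ 2) ≤ n ^ 2 ∨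
      3 * (r ^ 2 + r * (s - n) + (s - n) ^ 2) ≤ n ^ 2 := by
  by_contra! ⟨h0, h1, h2⟩
  have e0 := mul_le_mul_of_nonneg_left h0.le (sub_nonneg.2 h)
  have e1 := mul_le_mul_of_nonneg_left h1.le hr
  have e2 := mul_le_mul_of_nonneg_left h2.le hs
  have e : n * (n ^ 2) ≤ n * (3 * (n * (r + s)) - 3 * (r ^ 2 + r * s + s ^ 2)) := by
    linear_combination e0 + e1 + e2
  have e' := le_of_mul_le_mul_left e hn
  nlinarith [sq_nonneg (3 * (r + s) - 2 * n), sq_nonneg (r - s)]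

/-- The covering radius of the hexagonal lattice. -/
lemma exists_hexagonal_approx (x y : ℤ) {n : ℤ} (hn : 0 < n) : ∃ k l : ℤ,
    3 * ((x - n * k) ^ 2 + (x - n * k) * (y - n * l) + (y - n * l) ^ 2) ≤ n ^ 2 := by
  obtain ⟨r, hr⟩ : ∃ r, r = x % n := ⟨_, rfl⟩
  obtain ⟨s, hs⟩ : ∃ s, s = y % n := ⟨_, rfl⟩
  have hx : x = n * (x / n) + r := by rw [hr, Int.mul_ediv_add_emod]
  have hy : y = n * (y / n) + s := by rw [hs, Int.mul_ediv_add_emod]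
  have hr0 : 0 ≤ r := hr ▸ Int.emod_nonneg _ hn.ne'
  have hs0 : 0 ≤ s := hs ▸ Int.emod_nonneg _ hn.ne'
  have hrn : r < n := hr ▸ Int.emod_lt_of_pos _ hn
  have hsn : s < n := hs ▸ Int.emod_lt_of_pos _ hn
  have key : ∀ e f : ℤ,
      3 * ((r - n * e) ^ 2 + (r - n * e) * (s - n * f) + (s - n * f) ^ 2) ≤ n ^ 2 →
      ∃ k l : ℤ, 3 * ((x - n * k) ^ 2 + (x - n * k) * (y - n * l) + (y - n * l) ^ 2) ≤ n ^ 2 := by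
    intro e f h
    refine ⟨x / n + e, y / n + f, ?_⟩
    rw [show x - n * (x / n + e) = r - n * e by linear_combination hx,
      show y - n * (y / n + f) = s - n * f by linear_combination hy]
    exact h
  rcases le_total (r + s) n with h | h
  · rcases hexagonal_triangle hn hr0 hs0 h with h | h | h
    · exact key 0 0 (by linear_combination h)
    · exact key 1 0 (by linear_combination h)
    · exact key 0 1 (by linear_combination h)
  · rcases hexagonal_triangle (r := n - r) (s := n - s) hn (by omega) (by omega) (by omega)
      with h | h | h
    · exact key 1 1 (by linear_combination h)
    · exact key 0 1 (by linear_combination h)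
    · exact key 1 0 (by linear_combination h)

lemma exists_nrm_sub_lt (x : QuatOrder ℤ) {n : ℤ} (hn : 0 < n) :
    ∃ k : QuatOrder ℤ, nrm (x - (n : QuatOrder ℤ) * k) < n ^ 2 := by
  obtain ⟨kc, kd, h1⟩ := exists_hexagonal_approx x.c x.d hn
  obtain ⟨ka, kb, h2⟩ := exists_hexagonal_approx
    (3 * x.a + (x.c - n * kc) + 2 * (x.d - n * kd)) (3 * x.b - 2 * (x.c - n * kc) - (x.d - n * kd))
    (n := 3 * n) (by positivity)
  refine ⟨⟨ka, kb, kc, kd⟩, ?_⟩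
  have hpos : 0 < n ^ 2 := by positivity
  simp only [nrm, sub_a, sub_b, sub_c, sub_d, mul_a, mul_b, mul_c, mul_d, intCast_a, intCast_b,
    intCast_c, intCast_d, Int.cast_id]
  linarith

lemma exists_nrm_sub_mul_lt (x : QuatOrder ℤ) {y : QuatOrder ℤ} (hy : y ≠ 0) :
    ∃ k : QuatOrder ℤ, nrm (x - y * k) < nrm y := by
  have hpos : 0 < nrm y :=
    lt_of_le_of_ne (nrm_nonneg y) fun h => hy (eq_zero_of_nrm_eq_zero h.symm)
  obtain ⟨k, hk⟩ := exists_nrm_sub_lt (conj y * x) hpos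
  refine ⟨k, lt_of_mul_lt_mul_left ?_ hpos.le⟩
  calc nrm y * nrm (x - y * k) = nrm (conj y * (x - y * k)) := by rw [nrm_mul, nrm_conj]
    _ = nrm (conj y * x - ((nrm y : ℤ) : QuatOrder ℤ) * k) := by rw [mul_sub, ← mul_assoc, conj_mul]
    _ < nrm y * nrm y := by rwa [← sq]

lemma conj_dvd_intCast {p : ℤ} {x : QuatOrder ℤ} (h : (p : QuatOrder ℤ) ∣ conj x) :
    (p : QuatOrder ℤ) ∣ x := by
  obtain ⟨y, hy⟩ := h
  refine ⟨conj y, ?_⟩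
  rw [← conj_conj x, hy]
  ext <;> simp [conj]; ring

/-- Every element of norm divisible by the prime `p` that is primitive at `p` has a left divisor of
norm `p`. -/
lemma exists_factor {p : ℤ} (hp : Prime p) (hp0 : 0 < p) {x : QuatOrder ℤ} (hpx : p ∣ nrm x)
    (hx : ¬ (p : QuatOrder ℤ) ∣ x) : ∃ y z : QuatOrder ℤ, nrm y = p ∧ x = y * z := by
  classical
  have hex : ∃ n : ℕ, 0 < n ∧ ∃ s t : QuatOrder ℤ, nrm (x * s + (p : QuatOrder ℤ) * t) = (n : ℤ) :=
    ⟨(p ^ 2).toNat, by have : 0 < p ^ 2 := by positivity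
                       omega, 0, 1, by
      rw [mul_zero, zero_add, mul_one, nrm_intCast]; simp [sq_nonneg]⟩
  obtain ⟨hm, s, t, hst⟩ := Nat.find_spec hex
  set m := Nat.find hex with hmdef
  set y := x * s + (p : QuatOrder ℤ) * t with hy
  have hy0 : y ≠ 0 := by
    intro h; rw [h] at hst; simp [nrm] at hst; omega
  have hdiv : ∀ s' t' : QuatOrder ℤ, ∃ k, x * s' + (p : QuatOrder ℤ) * t' = y * k := by
    intro s' t'
    obtain ⟨k, hk⟩ := exists_nrm_sub_mul_lt (x * s' + (p : QuatOrder ℤ) * t') hy0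
    refine ⟨k, sub_eq_zero.1 (eq_zero_of_nrm_eq_zero ?_)⟩
    by_contra h0
    refine Nat.find_min hex (m := (nrm (x * s' + (p : QuatOrder ℤ) * t' - y * k)).toNat) ?_
      ⟨?_, s' - s * k, t' - t * k, ?_⟩
    · rw [← hmdef]; omega
    · have := nrm_nonneg (x * s' + (p : QuatOrder ℤ) * t' - y * k); omega
    · rw [Int.toNat_of_nonneg (nrm_nonneg _), hy]; congr 1; noncomm_ring
  obtain ⟨z, hz⟩ := hdiv 1 0
  obtain ⟨w, hw⟩ := hdiv 0 1
  simp only [mul_one, mul_zero, add_zero, zero_add] at hz hw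
  refine ⟨y, z, ?_, hz⟩
  have hn : nrm y * nrm w = p ^ 2 := by rw [← nrm_mul, ← hw, nrm_intCast]; rfl
  have hdvd : nrm y ∣ p ^ 2 := Dvd.intro _ hn
  obtain ⟨i, hi, hassoc⟩ := (dvd_prime_pow hp 2).1 hdvd
  have hyi : nrm y = p ^ i := by
    rcases Int.associated_iff.1 hassoc with h | h
    · exact h
    · have := nrm_nonneg y
      have : 0 < p ^ i := by positivity
      omega
  interval_cases i
  · exfalso
    apply hx
    apply conj_dvd_intCast
    obtain ⟨q, hq⟩ := hpx
    refine ⟨((q : QuatOrder ℤ) * s + conj x * t) * conj y, ?_⟩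
    have h1 : conj x * y = (p : QuatOrder ℤ) * ((q : QuatOrder ℤ) * s + conj x * t) := by
      rw [hy, mul_add, ← mul_assoc, conj_mul, hq, mul_add, ← mul_assoc, ← mul_assoc, ← mul_assoc,
        Int.cast_mul, (Int.cast_commute p (conj x)).eq]
    rw [← mul_assoc, ← h1, mul_assoc, mul_conj, hyi]; simp
  · simpa using hyi
  · exfalso
    apply hx
    have hw1 : nrm w = 1 := by
      rw [hyi] at hn
      exact mul_left_cancel₀ (pow_ne_zero 2 hp.ne_zero) (hn.trans (mul_one _).symm)
    refine ⟨conj w * z, ?_⟩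
    rw [← mul_assoc, hw, mul_assoc y, mul_conj, hw1]; simpa using hz

lemma exists_nrm_eq_prime {p : ℕ} (hp : p.Prime) : ∃ x : QuatOrder ℤ, nrm x = p := by
  rcases hp.eq_two_or_odd' with rfl | hodd
  · exact ⟨⟨0, 0, 1, 0⟩, by simp [nrm]⟩
  have : Fact p.Prime := ⟨hp⟩
  have h2 : (2 : ZMod p) ≠ 0 := by
    intro h
    have : p ∣ 2 := (ZMod.natCast_eq_zero_iff 2 p).1 (by exact_mod_cast h)
    have := (Nat.prime_dvd_prime_iff_eq hp Nat.prime_two).1 this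
    subst this
    exact absurd hodd (by decide)
  obtain ⟨s, t, hst⟩ := FiniteField.exists_root_sum_quadratic (R := ZMod p)
    (f := Polynomial.X ^ 2) (g := Polynomial.C 2 * Polynomial.X ^ 2 + Polynomial.C 0 * Polynomial.X
      + Polynomial.C 5) (by simp) (Polynomial.degree_quadratic h2) (by
        rw [ZMod.card]; exact Nat.odd_iff.1 hodd)
  obtain ⟨s, rfl⟩ := ZMod.intCast_surjective s
  obtain ⟨t, rfl⟩ := ZMod.intCast_surjective t
  have hdvd : (p : ℤ) ∣ s ^ 2 + 2 * t ^ 2 + 5 := by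
    rw [← ZMod.intCast_zmod_eq_zero_iff_dvd]
    push_cast
    simpa [add_assoc] using hst
  obtain ⟨y, -, hy, -⟩ := exists_factor (x := ⟨s + 1, 0, 1 - t, -2⟩)
    (Nat.prime_iff_prime_int.1 hp) (by exact_mod_cast hp.pos)
    (by convert hdvd using 1; simp only [nrm]; ring) (by
      rintro ⟨y, hy⟩
      have h := congrArg QuatOrder.d hy
      simp only [mul_d, intCast_a, intCast_b, intCast_c, intCast_d] at h
      have : (p : ℤ) ∣ 2 := ⟨-y.d, by simp at h; linarith⟩
      have : p ∣ 2 := by exact_mod_cast this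
      exact h2 (by exact_mod_cast (ZMod.natCast_eq_zero_iff 2 p).2 this))
  exact ⟨y, hy⟩

lemma exists_nrm_eq (n : ℕ) : ∃ x : QuatOrder ℤ, nrm x = n := by
  induction n using induction_on_primes with
  | zero => exact ⟨0, by simp [nrm]⟩
  | one => exact ⟨1, by simp [nrm]⟩
  | prime_mul p n hp ih =>
    obtain ⟨x, hx⟩ := exists_nrm_eq_prime hp
    obtain ⟨y, hy⟩ := ih
    exact ⟨x * y, by rw [nrm_mul, hx, hy]; push_cast; rfl⟩

/-- Reduction of coefficients modulo `4`. -/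
def reduce (x : QuatOrder ℤ) : QuatOrder (ZMod 4) := ⟨x.a, x.b, x.c, x.d⟩

lemma reduce_mul (x y : QuatOrder ℤ) : reduce (x * y) = reduce x * reduce y := by
  ext <;> simp [reduce]

lemma reduce_unit : reduce unit = unit := by ext <;> simp [reduce, unit]

lemma nrm_reduce (x : QuatOrder ℤ) : nrm (reduce x) = (nrm x : ℤ) := by simp [reduce, nrm]

/-- The elements that normalise `ℤ[u]` modulo `4`: those commuting with `u` modulo `4`, and those
intertwining `u` with its conjugate modulo `4`. -/
def Normalizes (x : QuatOrder ℤ) : Prop :=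
  (4 ∣ x.c ∧ 4 ∣ x.d) ∨ (4 ∣ x.c - x.a - 2 * x.b ∧ 4 ∣ x.d + 2 * x.a + x.b)

lemma normalizes_iff {x : QuatOrder ℤ} : Normalizes x ↔
    ((x.c : ZMod 4) = 0 ∧ (x.d : ZMod 4) = 0) ∨
      ((x.c : ZMod 4) = x.a + 2 * x.b ∧ (x.d : ZMod 4) = -2 * x.a - x.b) := by
  have h (n : ℤ) : 4 ∣ n ↔ (n : ZMod 4) = 0 := (ZMod.intCast_zmod_eq_zero_iff_dvd n 4).symm
  simp only [Normalizes, h]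
  push_cast
  refine or_congr_right (and_congr ?_ ?_)
  · rw [← sub_eq_zero (b := (x.a : ZMod 4) + 2 * x.b)]; ring_nf
  · rw [← sub_eq_zero (b := -2 * (x.a : ZMod 4) - x.b)]; ring_nf

lemma Normalizes.mul {x y : QuatOrder ℤ} (hx : Normalizes x) (hy : Normalizes y) :
    Normalizes (x * y) := by
  rw [normalizes_iff] at *
  simp only [mul_a, mul_b, mul_c, mul_d]
  push_cast
  rcases hx with ⟨hc, hd⟩ | ⟨hc, hd⟩ <;> rcases hy with ⟨hc', hd'⟩ | ⟨hc', hd'⟩ <;>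
    rw [hc, hd, hc', hd'] <;>
    generalize (x.a : ZMod 4) = a, (x.b : ZMod 4) = b, (y.a : ZMod 4) = a', (y.b : ZMod 4) = b'
  · left; revert a b a' b'; decide
  · right; revert a b a' b'; decide
  · right; revert a b a' b'; decide
  · left; revert a b a' b'; decide

lemma normalizes_of_nrm_eq_one {x : QuatOrder ℤ} (h : nrm x = 1) : Normalizes x := by
  obtain ⟨hc, hd⟩ := c_eq_zero_and_d_eq_zero h.le
  simp [Normalizes, hc, hd]

lemma normalizes_intCast (n : ℤ) : Normalizes (n : QuatOrder ℤ) := by simp [Normalizes]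

/-- The lattice on which the norm form is `s ^ 2 + 2 t ^ 2 + 5 v ^ 2 + 10 w ^ 2`. -/
def InDiagonal (x : QuatOrder ℤ) : Prop := 4 ∣ x.b ∧ 2 ∣ x.d

/-- Multiplication by powers of the unit `u` on both sides. -/
def twist {R : Type*} [CommRing R] (i j : ℕ) (x : QuatOrder R) : QuatOrder R :=
  (unit * ·)^[i] ((· * unit)^[j] x)

lemma nrm_twist {R : Type*} [CommRing R] (i j : ℕ) (x : QuatOrder R) :
    nrm (twist i j x) = nrm x := by
  unfold twist
  induction i with
  | zero =>
    induction j with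
    | zero => rfl
    | succ j ih =>
      simp only [Function.iterate_zero, id] at ih ⊢
      rw [Function.iterate_succ_apply', nrm_mul, ih, nrm_unit, mul_one]
  | succ i ih => rw [Function.iterate_succ_apply', nrm_mul, ih, nrm_unit, one_mul]

lemma reduce_twist (i j : ℕ) (x : QuatOrder ℤ) : reduce (twist i j x) = twist i j (reduce x) := by
  unfold twist
  induction i with
  | zero =>
    induction j with
    | zero => rfl
    | succ j ih =>
      simp only [Function.iterate_zero, id] at ih ⊢
      rw [Function.iterate_succ_apply', Function.iterate_succ_apply', reduce_mul, ih, reduce_unit]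
  | succ i ih =>
    rw [Function.iterate_succ_apply', Function.iterate_succ_apply', reduce_mul, ih, reduce_unit]

set_option maxRecDepth 10000 in
lemma exists_twist_zmod_of_nrm_eq_one : ∀ a b c d : ZMod 4,
    nrm (⟨a, b, c, d⟩ : QuatOrder (ZMod 4)) = 1 →
    ∃ i j : Fin 3, (twist i j (⟨a, b, c, d⟩ : QuatOrder (ZMod 4))).b = 0 ∧
      2 * (twist i j (⟨a, b, c, d⟩ : QuatOrder (ZMod 4))).d = 0 := by decide

end QuatOrder

/-- Thue's lemma. -/
lemma exists_small_solution (r : ℤ) {N : ℕ} (hN : 0 < N) :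
    ∃ x y : ℤ, (x ≠ 0 ∨ y ≠ 0) ∧ x ^ 2 ≤ N ∧ y ^ 2 ≤ N ∧ (N : ℤ) ∣ x - r * y := by
  have : NeZero N := ⟨hN.ne'⟩
  set A := Nat.sqrt N
  have hA : A * A ≤ N := Nat.sqrt_le N
  let f : Fin (A + 1) × Fin (A + 1) → ZMod N := fun v => (v.1 : ℤ) - (r : ZMod N) * (v.2 : ℤ)
  obtain ⟨⟨⟨x, hx⟩, ⟨y, hy⟩⟩, ⟨⟨x', hx'⟩, ⟨y', hy'⟩⟩, hne, heq⟩ :=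
    Fintype.exists_ne_map_eq_of_card_lt f (by
      simp only [ZMod.card, Fintype.card_prod, Fintype.card_fin]; exact Nat.lt_succ_sqrt N)
  have hbound : ∀ {s t : ℕ}, s < A + 1 → t < A + 1 → ((s : ℤ) - t) ^ 2 ≤ N := by
    intro s t hs ht
    have hA' : (A : ℤ) * A ≤ N := by exact_mod_cast hA
    nlinarith
  refine ⟨x - x', y - y', ?_, hbound hx hx', hbound hy hy', ?_⟩
  · by_contra! h
    apply hne
    simp only [Prod.mk.injEq, Fin.mk.injEq]
    omega
  · rw [← ZMod.intCast_zmod_eq_zero_iff_dvd]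
    simp only [f] at heq
    push_cast at heq ⊢
    linear_combination heq

/-- `-10` is a square modulo primes congruent to `7` modulo `40`. -/
lemma isSquare_neg_ten {d : ℕ} [Fact d.Prime] (hd : d % 40 = 7) : IsSquare (-10 : ZMod d) := by
  have h0 : (10 : ZMod d) ≠ 0 := by
    intro h
    have hdvd : d ∣ 10 := (ZMod.natCast_eq_zero_iff 10 d).1 (by exact_mod_cast h)
    have := Nat.le_of_dvd (by norm_num) hdvd
    rw [show d = 7 by omega] at hdvd
    omega
  have h2 : legendreSym d (-2) = -1 := by
    rw [legendreSym.eq_neg_one_iff]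
    push_cast
    rw [ZMod.exists_sq_eq_neg_two_iff (by omega)]
    omega
  have h5 : legendreSym d 5 = -1 := by
    rw [legendreSym.eq_neg_one_iff]
    have hns : ¬ IsSquare (2 : ZMod 5) := by decide
    have : Fact (Nat.Prime 5) := ⟨by norm_num⟩
    have h := ZMod.exists_sq_eq_prime_iff_of_mod_four_eq_one (p := 5) (q := d) (by norm_num)
      (by omega)
    push_cast at h ⊢
    rwa [← h, show ((d : ℕ) : ZMod 5) = 2 from
      (ZMod.natCast_eq_natCast_iff d 2 5).2 (by change d % 5 = 2 % 5; omega)]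
  have h10 : legendreSym d (-10) = 1 := by
    rw [show (-10 : ℤ) = -2 * 5 by norm_num, legendreSym.mul, h2, h5]; norm_num
  have := (legendreSym.eq_one_iff d (a := -10) (by push_cast; exact neg_ne_zero.2 h0)).1 h10
  exact_mod_cast this

lemma exists_two_mul_sq_add_five_mul_sq {d : ℕ} (hp : d.Prime) (hd : d % 40 = 7) :
    ∃ z b : ℤ, 2 * z ^ 2 + 5 * b ^ 2 = d := by
  have : Fact d.Prime := ⟨hp⟩
  obtain ⟨s, hs⟩ := isSquare_neg_ten hd
  have h2 : (2 : ZMod d) ≠ 0 := by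
    intro h
    have := Nat.le_of_dvd two_pos ((ZMod.natCast_eq_zero_iff 2 d).1 (by exact_mod_cast h))
    omega
  obtain ⟨r, hr⟩ := ZMod.intCast_surjective (s / 2)
  obtain ⟨z, b, hne, hz, hb, hdvd⟩ := exists_small_solution r hp.pos
  have hdm : (d : ℤ) ∣ 2 * z ^ 2 + 5 * b ^ 2 := by
    rw [← ZMod.intCast_zmod_eq_zero_iff_dvd] at hdvd ⊢
    push_cast at hdvd ⊢
    rw [sub_eq_zero.1 hdvd, hr]
    field_simp
    linear_combination -(b : ZMod d) ^ 2 * hs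
  obtain ⟨m, hm⟩ := hdm
  have hd0 : (0 : ℤ) < d := by exact_mod_cast hp.pos
  have hm7 : m ≤ 7 := by nlinarith
  have hm0 : 0 < m := by
    have : 0 < 2 * z ^ 2 + 5 * b ^ 2 := by rcases hne with h | h <;> positivity
    exact pos_of_mul_pos_right (hm ▸ this) hd0.le
  rw [show (d : ℤ) = 40 * (d / 40) + 7 by omega] at hm ⊢
  generalize (d : ℤ) / 40 = q at hm ⊢
  have hz5' : z ^ 2 % 5 = 0 ∧ 5 ∣ z ∨ z ^ 2 % 5 = 1 ∨ z ^ 2 % 5 = 4 := by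
    rcases (by omega : z % 5 = 0 ∨ z % 5 = 1 ∨ z % 5 = 2 ∨ z % 5 = 3 ∨ z % 5 = 4) with
      h | h | h | h | h <;> simp [sq, Int.mul_emod, h, Int.dvd_iff_emod_eq_zero]
  have sq8 (x : ℤ) : (x ^ 2 % 8 = 0 ∨ x ^ 2 % 8 = 1 ∨ x ^ 2 % 8 = 4) := by
    rcases (by omega : x % 8 = 0 ∨ x % 8 = 1 ∨ x % 8 = 2 ∨ x % 8 = 3 ∨ x % 8 = 4 ∨ x % 8 = 5 ∨
      x % 8 = 6 ∨ x % 8 = 7) with h | h | h | h | h | h | h | h <;> simp [sq, Int.mul_emod, h]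
  have even_of_even_sq {x : ℤ} (h : 2 ∣ x ^ 2) : 2 ∣ x := Int.prime_two.dvd_of_dvd_pow h
  obtain rfl | rfl | rfl | rfl : m = 1 ∨ m = 4 ∨ m = 5 ∨ m = 6 := by interval_cases m <;> omega
  · exact ⟨z, b, by linarith⟩
  · obtain ⟨b, rfl⟩ := even_of_even_sq (x := b) (by omega)
    obtain ⟨z, rfl⟩ := even_of_even_sq (x := z) (by ring_nf at hm ⊢; omega)
    exact ⟨z, b, by linarith⟩
  · obtain ⟨z, rfl⟩ : 5 ∣ z := by omega
    have := sq8 z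
    have := sq8 b
    ring_nf at hm
    omega
  · obtain ⟨b, rfl⟩ := even_of_even_sq (x := b) (by omega)
    have := sq8 z
    have := sq8 b
    ring_nf at hm
    omega

lemma exists_sq_add_dvd_pow {p : ℕ} (hp : p.Prime) (hp2 : p ≠ 2) {d r : ℤ}
    (hr : (p : ℤ) ∣ r ^ 2 + d) (hd : ¬ (p : ℤ) ∣ d) (k : ℕ) : ∃ s : ℤ, (p : ℤ) ^ k ∣ s ^ 2 + d := by
  have hpZ := Nat.prime_iff_prime_int.1 hp
  suffices ∃ s : ℤ, (p : ℤ) ^ (k + 1) ∣ s ^ 2 + d by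
    obtain ⟨s, hs⟩ := this
    exact ⟨s, (pow_dvd_pow _ k.le_succ).trans hs⟩
  induction k with
  | zero => exact ⟨r, by simpa using hr⟩
  | succ k ih =>
    obtain ⟨s, t, ht⟩ := ih
    have hs : ¬ (p : ℤ) ∣ 2 * s := by
      intro h
      rcases hpZ.dvd_or_dvd h with h | h
      · exact hp2 ((Nat.prime_dvd_prime_iff_eq hp Nat.prime_two).1 (by exact_mod_cast h))
      · apply hd
        have h1 : (p : ℤ) ∣ s ^ 2 + d := ht ▸ (dvd_pow_self _ k.succ_ne_zero).mul_right t
        exact (dvd_add_right (dvd_pow h two_ne_zero)).1 h1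
    obtain ⟨u, v, huv⟩ := ((Prime.coprime_iff_not_dvd hpZ).2 hs)
    refine ⟨s - p ^ (k + 1) * (v * t), t * u + p ^ k * (v * t) ^ 2, ?_⟩
    linear_combination ht - p ^ (k + 1) * t * huv

lemma exists_proportional_norm {p : ℕ} (hp : p.Prime) {d : ℕ} (hd : 0 < d) {k : ℕ} {r : ℤ}
    (hr : (p : ℤ) ^ k ∣ r ^ 2 + d) : ∃ g q x y : ℤ, (0 < g ∧ g ≤ d + 1) ∧ (0 < q ∧ q ≤ d + 1) ∧
      IsCoprime x y ∧ g * (x ^ 2 + d * y ^ 2) = p ^ k * q := by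
  obtain ⟨x, y, hne, hx, hy, hdvd⟩ := exists_small_solution r (pow_pos hp.pos k)
  push_cast at hx hy hdvd
  have hP : (0 : ℤ) < (p : ℤ) ^ k := by have := hp.pos; positivity
  have hgcd : 0 < Int.gcd x y := Int.gcd_pos_iff.2 hne
  obtain ⟨g, x, y, hg, hxy, rfl, rfl⟩ : ∃ g x' y' : ℤ, 0 < g ∧ IsCoprime x' y' ∧ x = g * x' ∧
      y = g * y' := by
    obtain ⟨x', y', hc, h1, h2⟩ := Int.exists_gcd_one hgcd
    exact ⟨Int.gcd x y, x', y', by exact_mod_cast hgcd, Int.isCoprime_iff_gcd_eq_one.2 hc,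
      by linarith, by linarith⟩
  have hM : (p : ℤ) ^ k ∣ g * (x ^ 2 + d * y ^ 2) := by
    have h1 : (p : ℤ) ^ k ∣ (g * x - r * (g * y)) * (x + r * y) + g * y ^ 2 * (r ^ 2 + d) :=
      dvd_add (hdvd.mul_right _) (hr.mul_left _)
    convert h1 using 1; ring
  obtain ⟨q, hq⟩ := hM
  have hMpos : 0 < x ^ 2 + d * y ^ 2 := by
    have hd' : (0 : ℤ) < d := by exact_mod_cast hd
    rcases hne with h | h
    · have := right_ne_zero_of_mul h; positivity
    · have := right_ne_zero_of_mul h; positivity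
  have hq0 : 0 < q := pos_of_mul_pos_right (hq ▸ mul_pos hg hMpos) hP.le
  have hgq : g * q ≤ d + 1 := by
    refine le_of_mul_le_mul_left (a := (p : ℤ) ^ k) ?_ hP
    have : (p : ℤ) ^ k * (g * q) = (g * x) ^ 2 + d * (g * y) ^ 2 := by
      linear_combination -g * hq
    rw [this]
    nlinarith
  exact ⟨g, q, x, y, ⟨hg, by nlinarith⟩, ⟨hq0, by nlinarith⟩, hxy, hq⟩

lemma sq_eq_sq_of_coprime_of_mul_eq {x y x' y' : ℤ} (h : IsCoprime x y) (h' : IsCoprime x' y')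
    (heq : x' * y = x * y') : x ^ 2 = x' ^ 2 := by
  have h1 : x ∣ x' := h.dvd_of_dvd_mul_right (heq ▸ dvd_mul_right _ _)
  have h2 : x' ∣ x := h'.dvd_of_dvd_mul_right (heq ▸ dvd_mul_right _ _)
  exact Int.natAbs_eq_iff_sq_eq.1
    (Nat.dvd_antisymm (Int.natAbs_dvd_natAbs.2 h1) (Int.natAbs_dvd_natAbs.2 h2))

/-- If `-d` is a square modulo the odd prime `p`, some power of `p` is nontrivially a norm
from `ℤ[√-d]`. -/
lemma exists_pow_eq_sq_add {p : ℕ} (hp : p.Prime) (hp2 : p ≠ 2) {d : ℕ} (hd : 0 < d)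
    (hpd : ¬ (p : ℤ) ∣ d) {r : ℤ} (hr : (p : ℤ) ∣ r ^ 2 + d) :
    ∃ (h : ℕ) (x y : ℤ), y ≠ 0 ∧ x ^ 2 + d * y ^ 2 = p ^ h := by
  have hex : ∀ k : ℕ, ∃ g q x y : ℤ, (0 < g ∧ g ≤ d + 1) ∧ (0 < q ∧ q ≤ d + 1) ∧
      IsCoprime x y ∧ g * (x ^ 2 + d * y ^ 2) = p ^ k * q := fun k =>
    let ⟨_, hs⟩ := exists_sq_add_dvd_pow hp hp2 hr hpd k
    exists_proportional_norm hp hd hs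
  choose g q x y hg hq hxy heq using hex
  let L := (d + 1).factorial
  have : NeZero L := ⟨(Nat.factorial_pos _).ne'⟩
  let f : ℕ → Set.Icc (1 : ℤ) (d + 1) × Set.Icc (1 : ℤ) (d + 1) × ZMod L × ZMod L := fun k =>
    (⟨g k, (hg k).1, (hg k).2⟩, ⟨q k, (hq k).1, (hq k).2⟩, x k, y k)
  obtain ⟨k, l, hkl, hf⟩ := Finite.exists_ne_map_eq_of_infinite f
  have hgg : g k = g l := congrArg (fun v => (v.1 : ℤ)) hf
  have hqq : q k = q l := congrArg (fun v => (v.2.1 : ℤ)) hf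
  have hx : (x k : ZMod L) = x l := congrArg (fun v => v.2.2.1) hf
  have hy : (y k : ZMod L) = y l := congrArg (fun v => v.2.2.2) hf
  have hqL : q k ∣ L := by
    have := Nat.dvd_factorial (m := (q k).toNat) (n := d + 1)
      (by have := hq k; omega) (by have := hq k; omega)
    rw [← Int.natCast_dvd_natCast, Int.toNat_of_nonneg (hq k).1.le] at this
    exact this
  have hx' : q k ∣ x l - x k := hqL.trans ((ZMod.intCast_eq_intCast_iff_dvd_sub _ _ _).1 hx)
  have hy' : q k ∣ y l - y k := hqL.trans ((ZMod.intCast_eq_intCast_iff_dvd_sub _ _ _).1 hy)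
  have e1 := heq k
  have e2 := heq l
  rw [← hgg, ← hqq] at e2
  obtain ⟨X, hX⟩ : q k ∣ g k * (x k * x l + d * y k * y l) := by
    have : g k * (x k * x l + d * y k * y l) = p ^ k * q k
        + (g k * x k * (x l - x k) + g k * d * y k * (y l - y k)) := by
      linear_combination e1
    rw [this]
    exact dvd_add (dvd_mul_left _ _) (dvd_add (hx'.mul_left _) (hy'.mul_left _))
  obtain ⟨Y, hY⟩ : q k ∣ g k * (x l * y k - x k * y l) := by
    rw [show g k * (x l * y k - x k * y l) = g k * y k * (x l - x k) - g k * x k * (y l - y k) by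
      ring]
    exact dvd_sub (hx'.mul_left _) (hy'.mul_left _)
  refine ⟨k + l, X, Y, ?_, ?_⟩
  · rintro rfl
    have h0 : x l * y k = x k * y l := by
      rw [mul_zero] at hY
      exact sub_eq_zero.1 ((mul_eq_zero.1 hY).resolve_left (hg k).1.ne')
    have hxx := sq_eq_sq_of_coprime_of_mul_eq (hxy k) (hxy l) h0
    have hyy := sq_eq_sq_of_coprime_of_mul_eq (hxy k).symm (hxy l).symm (by linarith)
    rw [hxx, hyy, e2] at e1
    have := mul_right_cancel₀ (hq k).1.ne' e1
    exact hkl ((Nat.pow_right_injective hp.two_le (by exact_mod_cast this)).symm)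
  · refine mul_left_cancel₀ (pow_ne_zero 2 (hq k).1.ne') ?_
    linear_combination -(q k * X + g k * (x k * x l + d * y k * y l)) * hX
      - d * (q k * Y + g k * (x l * y k - x k * y l)) * hY + g k * (x l ^ 2 + d * y l ^ 2) * e1
      + p ^ k * q k * e2

lemma exists_primitive_pow_eq_sq_add {p : ℕ} (hp : p.Prime) {d : ℕ} (hd : 1 < d)
    (hpd : ¬ (p : ℤ) ∣ d) {h : ℕ} {x y : ℤ} (hy : y ≠ 0) (hxy : x ^ 2 + d * y ^ 2 = p ^ h) :
    ∃ (k : ℕ) (s t : ℤ), 0 < k ∧ ¬ (p : ℤ) ∣ s ∧ s ^ 2 + d * t ^ 2 = p ^ k := by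
  have hpZ := Nat.prime_iff_prime_int.1 hp
  have hd' : (1 : ℤ) < d := by exact_mod_cast hd
  induction h using Nat.strong_induction_on generalizing x y with
  | _ h ih =>
    have hy2 : 0 < y ^ 2 := by positivity
    have hh : h ≠ 0 := by
      rintro rfl
      rw [pow_zero] at hxy
      nlinarith [sq_nonneg x]
    by_cases hx : (p : ℤ) ∣ x
    · have hpy : (p : ℤ) ∣ y := by
        have h1 : (p : ℤ) ∣ x ^ 2 + d * y ^ 2 := hxy ▸ dvd_pow_self _ hh
        have h2 := (dvd_add_right (dvd_pow hx two_ne_zero)).1 h1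
        exact hpZ.dvd_of_dvd_pow ((hpZ.dvd_or_dvd h2).resolve_left hpd)
      obtain ⟨x, rfl⟩ := hx
      obtain ⟨y, rfl⟩ := hpy
      have hy0 : y ≠ 0 := right_ne_zero_of_mul hy
      have h1 : h ≠ 1 := by
        rintro rfl
        have : (p : ℤ) * (x ^ 2 + d * y ^ 2) = 1 :=
          mul_left_cancel₀ hpZ.ne_zero (by linear_combination hxy)
        exact hpZ.not_isUnit (IsUnit.of_mul_eq_one _ this)
      obtain ⟨m, rfl⟩ : ∃ m, h = m + 2 := ⟨h - 2, by omega⟩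
      have hm : x ^ 2 + d * y ^ 2 = (p : ℤ) ^ m :=
        mul_left_cancel₀ (pow_ne_zero 2 hpZ.ne_zero) (by linear_combination hxy)
      exact ih m (by omega) hy0 hm
    · exact ⟨h, x, y, by omega, hx, hxy⟩

lemma sq_emod_four (x : ℤ) : x ^ 2 % 4 = 0 ∨ x ^ 2 % 4 = 1 := by
  rcases Int.even_or_odd x with ⟨y, rfl⟩ | ⟨y, rfl⟩ <;> ring_nf <;> omega

lemma exists_sq_of_mul_eq_sq {a b c : ℤ} (h : IsCoprime a b) (heq : a * b = c ^ 2) (ha : 0 < a) :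
    ∃ e : ℤ, a = e ^ 2 := by
  obtain ⟨e, he | he⟩ := Int.sq_of_isCoprime h heq
  · exact ⟨e, he⟩
  · nlinarith [sq_nonneg e]

/-- A minimal primitive power of `p` represented by `s ^ 2 + d t ^ 2` has odd exponent, for
a prime `d` congruent to `3` modulo `4`. -/
lemma exists_odd_pow_eq_sq_add {p d : ℕ} (hp : p.Prime) (hp2 : p ≠ 2) (hd : d.Prime)
    (hd4 : d % 4 = 3) (hpd : ¬ (p : ℤ) ∣ d) {r : ℤ} (hr : (p : ℤ) ∣ r ^ 2 + d) :
    ∃ (k : ℕ) (s t : ℤ), Odd k ∧ s ^ 2 + d * t ^ 2 = p ^ k := by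
  classical
  have hpZ := Nat.prime_iff_prime_int.1 hp
  have hdZ := Nat.prime_iff_prime_int.1 hd
  have hd0 : (0 : ℤ) < d := by exact_mod_cast hd.pos
  obtain ⟨h, x, y, hy, hxy⟩ := exists_pow_eq_sq_add hp hp2 hd.pos hpd hr
  have hex : ∃ k : ℕ, ∃ s t : ℤ, 0 < k ∧ ¬ (p : ℤ) ∣ s ∧ s ^ 2 + d * t ^ 2 = p ^ k :=
    exists_primitive_pow_eq_sq_add hp hd.one_lt hpd hy hxy
  obtain ⟨s, t, hk, hs, hst⟩ := Nat.find_spec hex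
  have hmin : ∀ j < Nat.find hex, ¬ ∃ s t : ℤ, 0 < j ∧ ¬ (p : ℤ) ∣ s ∧ s ^ 2 + d * t ^ 2 = p ^ j :=
    fun j => Nat.find_min hex
  generalize Nat.find hex = k at hk hst hmin
  rcases Nat.even_or_odd k with ⟨j, rfl⟩ | hodd
  swap
  · exact ⟨k, s, t, hodd, hst⟩
  exfalso
  obtain ⟨P, hP⟩ : ∃ P : ℤ, P = p ^ j := ⟨_, rfl⟩
  have hP0 : 0 < P := by have := hp.pos; rw [hP]; positivity
  have hPodd : Odd P := by
    rw [hP]; exact_mod_cast (hp.odd_of_ne_two hp2).pow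
  have hprod : (P - s) * (P + s) = d * t ^ 2 := by
    rw [pow_add, ← hP] at hst; linear_combination -hst
  have ht : t ≠ 0 := by
    rintro rfl
    exact hs (hpZ.dvd_of_dvd_pow (n := 2) (by
      rw [show s ^ 2 = (p : ℤ) ^ (j + j) by linear_combination hst]
      exact dvd_pow_self _ hk.ne'))
  wlog hds : (d : ℤ) ∣ P + s generalizing s
  · refine this (-s) (by rwa [dvd_neg]) (by linear_combination hst) (by linear_combination hprod) ?_
    exact (hdZ.dvd_or_dvd (hprod ▸ dvd_mul_right _ _)).resolve_right hds
  have ht2 : 0 < d * t ^ 2 := by positivity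
  obtain ⟨hs1, hs2⟩ := abs_lt.1 (abs_lt_of_sq_lt_sq (a := s) (b := P) (by nlinarith) hP0.le)
  have hcop : IsCoprime P s := by
    rw [hP]; exact ((Prime.coprime_iff_not_dvd hpZ).2 hs).pow_left
  have hP2 := Int.odd_iff.1 hPodd
  rcases Int.even_or_odd s with hseven | hsodd
  · obtain ⟨w, hw⟩ := hds
    have hw0 : 0 < w := pos_of_mul_pos_right (hw ▸ (by linarith : 0 < P + s)) hd0.le
    have hodd : Odd (P - s) := hPodd.sub_even hseven
    have h1 : IsCoprime (P - s) (2 * s) := by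
      refine IsCoprime.mul_right (Int.isCoprime_two_right.2 hodd) ?_
      simpa [sub_eq_add_neg] using hcop.add_mul_left_left (-1)
    have h2 : IsCoprime (P - s) w := by
      refine IsCoprime.of_mul_right_right (y := (d : ℤ)) ?_
      have h := h1.add_mul_left_right 1
      rwa [show 2 * s + (P - s) * 1 = d * w by linear_combination hw] at h
    have h3 : (P - s) * w = t ^ 2 := mul_left_cancel₀ hd0.ne' (by
      linear_combination hprod - (P - s) * hw)
    obtain ⟨e, he⟩ := exists_sq_of_mul_eq_sq h2 h3 (by linarith)
    obtain ⟨f, hf⟩ := exists_sq_of_mul_eq_sq h2.symm (by rw [mul_comm, h3]) hw0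
    have h4 : e ^ 2 + d * f ^ 2 = 2 * P := by rw [← he, ← hf]; linarith
    rw [show (d : ℤ) = 4 * (d / 4) + 3 by omega] at h4
    have := sq_emod_four e
    have := sq_emod_four f
    generalize (d : ℤ) / 4 = q at h4
    rw [add_mul, mul_assoc] at h4
    generalize q * f ^ 2 = z at h4
    omega
  · obtain ⟨A, hA⟩ := (hPodd.sub_odd hsodd).two_dvd
    obtain ⟨B, hB⟩ := (hPodd.add_odd hsodd).two_dvd
    have hdB : (d : ℤ) ∣ B := by
      rw [hB] at hds
      refine (hdZ.dvd_or_dvd hds).resolve_left fun h => ?_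
      have := (Nat.prime_dvd_prime_iff_eq hd Nat.prime_two).1 (by exact_mod_cast h)
      omega
    obtain ⟨w, rfl⟩ := hdB
    have hw0 : 0 < w := pos_of_mul_pos_right (by linarith : 0 < d * w) hd0.le
    have hAw : IsCoprime A w := by
      obtain ⟨u, v, huv⟩ := hcop
      refine ⟨u - v, (u + v) * d, ?_⟩
      have h5 : P = A + d * w := by linarith
      have h6 : s = d * w - A := by linarith
      linear_combination huv - u * h5 - v * h6
    have h4 : 4 * (A * w) = t ^ 2 := mul_left_cancel₀ hd0.ne' (by
      rw [hA, hB] at hprod; linear_combination hprod)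
    obtain ⟨t, rfl⟩ := Int.prime_two.dvd_of_dvd_pow (show 2 ∣ t ^ 2 by omega)
    have h3 : A * w = t ^ 2 := by linarith
    obtain ⟨e, he⟩ := exists_sq_of_mul_eq_sq hAw h3 (by linarith)
    obtain ⟨f, hf⟩ := exists_sq_of_mul_eq_sq hAw.symm (by rw [mul_comm, h3]) hw0
    have hef : e ^ 2 + d * f ^ 2 = (p : ℤ) ^ j := by rw [← he, ← hf, ← hP]; linarith
    have hj : 0 < j := by omega
    refine hmin j (by omega) ⟨e, f, hj, fun hpe => hs ?_, hef⟩
    have h5 : s = (p : ℤ) ^ j - 2 * e ^ 2 := by rw [← hP, ← he]; linarith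
    rw [h5]
    exact dvd_sub (dvd_pow_self _ hj.ne') ((dvd_pow hpe two_ne_zero).mul_left _)

lemma exists_prime_mod_forty {p : ℕ} (hp : p.Prime) (hp4 : p % 4 = 3) :
    ∃ d : ℕ, d.Prime ∧ d % 40 = 7 ∧ p ∣ d + 1 ∧ p < d := by
  have hcop : Nat.Coprime 40 p := by
    refine ((Nat.Prime.coprime_iff_not_dvd hp).2 fun h => ?_).symm
    rw [show 40 = 2 ^ 3 * 5 by norm_num] at h
    rcases hp.dvd_mul.1 h with h | h
    · have := (Nat.prime_dvd_prime_iff_eq hp Nat.prime_two).1 (hp.dvd_of_dvd_pow h)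
      omega
    · have := (Nat.prime_dvd_prime_iff_eq hp Nat.prime_five).1 h
      omega
  obtain ⟨a, ha, ha'⟩ := Nat.chineseRemainder hcop 7 (p - 1)
  have hac : a.Coprime (40 * p) := by
    refine Nat.Coprime.mul_right ?_ ?_
    · exact ha.gcd_eq.trans (by norm_num)
    · refine ha'.gcd_eq.trans (Nat.Coprime.symm ?_)
      exact (Nat.coprime_self_sub_right hp.one_le).2 (Nat.coprime_one_right p)
  obtain ⟨d, hdp, hd, hda⟩ := Nat.forall_exists_prime_gt_and_modEq p
    (mul_ne_zero (by norm_num) hp.ne_zero) hac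
  refine ⟨d, hd, (hda.of_mul_right p).trans ha, ?_, hdp⟩
  have h := (((hda.of_mul_left 40).trans ha').add_right 1)
  rw [Nat.sub_add_cancel hp.one_le] at h
  exact (Nat.modEq_zero_iff_dvd.1 (h.trans (by simp [Nat.ModEq])))

namespace QuatOrder

lemma normalizes_of_nrm_eq_pow {p : ℕ} (hp : p.Prime)
    (h : ∀ x : QuatOrder ℤ, nrm x = p → Normalizes x) (k : ℕ) {x : QuatOrder ℤ}
    (hx : nrm x = p ^ k) : Normalizes x := by
  have hpZ := Nat.prime_iff_prime_int.1 hp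
  have hp0 : (0 : ℤ) < p := by exact_mod_cast hp.pos
  induction k using Nat.strong_induction_on generalizing x with
  | _ k ih =>
    rcases Nat.eq_zero_or_pos k with rfl | hk
    · exact normalizes_of_nrm_eq_one (by simpa using hx)
    by_cases hpx : (((p : ℤ)) : QuatOrder ℤ) ∣ x
    · obtain ⟨y, rfl⟩ := hpx
      rw [nrm_mul, nrm_intCast] at hx
      simp only [Int.cast_id] at hx
      have hk1 : k ≠ 1 := by
        rintro rfl
        have : (p : ℤ) * nrm y = 1 := mul_left_cancel₀ hp0.ne' (by linear_combination hx)
        exact hpZ.not_isUnit (IsUnit.of_mul_eq_one _ this)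
      obtain ⟨m, rfl⟩ : ∃ m, k = m + 2 := ⟨k - 2, by omega⟩
      have hy : nrm y = (p : ℤ) ^ m :=
        mul_left_cancel₀ (pow_ne_zero 2 hp0.ne') (by linear_combination hx)
      exact (normalizes_intCast _).mul (ih m (by omega) hy)
    · obtain ⟨y, z, hy, rfl⟩ := exists_factor hpZ hp0 (hx ▸ dvd_pow_self _ hk.ne') hpx
      obtain ⟨m, rfl⟩ : ∃ m, k = m + 1 := ⟨k - 1, by omega⟩
      rw [nrm_mul, hy] at hx
      have hz : nrm z = (p : ℤ) ^ m := mul_left_cancel₀ hp0.ne' (by linear_combination hx)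
      exact (h y hy).mul (ih m (by omega) hz)

lemma not_normalizes_diagonal {a z b : ℤ}
    (h : (a ^ 2 + 2 * z ^ 2 + 5 * b ^ 2) % 4 = 3) :
    ¬ Normalizes ⟨a + b, 0, -z + b, -2 * b⟩ := by
  have e1 := sq_emod_four a
  rintro (⟨⟨k, hk⟩, ⟨l, hl⟩⟩ | ⟨⟨k, hk⟩, ⟨l, hl⟩⟩) <;> dsimp only at hk hl
  · obtain ⟨b, rfl⟩ : 2 ∣ b := by omega
    obtain ⟨z, rfl⟩ : 2 ∣ z := by omega
    ring_nf at h
    omega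
  · obtain ⟨a, rfl⟩ : 2 ∣ a := by omega
    obtain ⟨z, rfl⟩ : 2 ∣ z := by omega
    have e2 := sq_emod_four b
    ring_nf at h
    omega

/-- For `p` congruent to `3` modulo `4`, the elements of norm `p` do not all normalise `ℤ[u]`
modulo `4`: otherwise so would all elements of norm a power of `p`, among them one of odd exponent
in the diagonal lattice. -/
lemma exists_nrm_eq_not_normalizes {p : ℕ} (hp : p.Prime) (hp4 : p % 4 = 3) :
    ∃ x : QuatOrder ℤ, nrm x = p ∧ ¬ Normalizes x := by
  by_contra! hall
  obtain ⟨d, hd, hd40, hpd, hlt⟩ := exists_prime_mod_forty hp hp4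
  have hp2 : p ≠ 2 := by omega
  have hndvd : ¬ (p : ℤ) ∣ d := fun h =>
    hlt.ne ((Nat.prime_dvd_prime_iff_eq hp hd).1 (by exact_mod_cast h))
  obtain ⟨k, s, t, ⟨m, rfl⟩, hst⟩ := exists_odd_pow_eq_sq_add hp hp2 hd (by omega) hndvd (r := 1)
    (by rw [one_pow, add_comm]; exact_mod_cast hpd)
  obtain ⟨z, b, hzb⟩ := exists_two_mul_sq_add_five_mul_sq hd hd40
  have hnorm : s ^ 2 + 2 * (t * z) ^ 2 + 5 * (t * b) ^ 2 = (p : ℤ) ^ (2 * m + 1) := by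
    linear_combination hst + t ^ 2 * hzb
  refine not_normalizes_diagonal (a := s) (z := t * z) (b := t * b) ?_
    (normalizes_of_nrm_eq_pow hp hall (2 * m + 1) ?_)
  · rw [hnorm]
    have h : (p : ℤ) ≡ -1 [ZMOD 4] := by rw [Int.ModEq]; omega
    exact (h.pow (2 * m + 1)).trans (by rw [Odd.neg_one_pow ⟨m, rfl⟩])
  · rw [← hnorm]; simp only [nrm]; ring

set_option maxRecDepth 10000 in
lemma exists_twist_zmod_of_nrm_eq_three : ∀ a b c d : ZMod 4,
    nrm (⟨a, b, c, d⟩ : QuatOrder (ZMod 4)) = 3 →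
    ¬ ((c = 0 ∧ d = 0) ∨ (c = a + 2 * b ∧ d = -2 * a - b)) →
    ∃ i j : Fin 3, (twist i j (⟨a, b, c, d⟩ : QuatOrder (ZMod 4))).b = 0 ∧
      2 * (twist i j (⟨a, b, c, d⟩ : QuatOrder (ZMod 4))).d = 0 := by decide

set_option maxRecDepth 10000 in
lemma exists_twist_zmod_eq_two : ∀ a b c d : ZMod 4,
    nrm (⟨a, b, c, d⟩ : QuatOrder (ZMod 4)) = 3 →
    ∃ i j : Fin 3, (twist i j (⟨a, b, c, d⟩ : QuatOrder (ZMod 4))).b = 2 ∧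
      (twist i j (⟨a, b, c, d⟩ : QuatOrder (ZMod 4))).d = 0 ∧
      2 * (twist i j (⟨a, b, c, d⟩ : QuatOrder (ZMod 4))).a = 2 := by decide

lemma two_mul_intCast_eq_zero {n : ℤ} (h : 2 * (n : ZMod 4) = 0) : 2 ∣ n := by
  have : (4 : ℤ) ∣ 2 * n := (ZMod.intCast_zmod_eq_zero_iff_dvd _ 4).1 (by exact_mod_cast h)
  omega

lemma inDiagonal_of_reduce {x : QuatOrder ℤ} (hb : (reduce x).b = 0) (hd : 2 * (reduce x).d = 0) :
    InDiagonal x :=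
  ⟨(ZMod.intCast_zmod_eq_zero_iff_dvd _ 4).1 hb, two_mul_intCast_eq_zero hd⟩

lemma exists_inDiagonal_of_prime {p : ℕ} (hp : p.Prime) (hp2 : p ≠ 2) :
    ∃ x : QuatOrder ℤ, nrm x = p ∧ InDiagonal x := by
  have hred {x : QuatOrder ℤ} {r : ℕ} (hx : nrm x = p) (hr : p % 4 = r % 4) :
      nrm (reduce x) = r := by
    rw [nrm_reduce, hx]
    exact_mod_cast (ZMod.natCast_eq_natCast_iff p r 4).2 hr
  have hodd := Nat.odd_iff.1 (hp.odd_of_ne_two hp2)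
  rcases (by omega : p % 4 = 1 ∨ p % 4 = 3) with h | h
  · obtain ⟨x, hx⟩ := exists_nrm_eq p
    obtain ⟨i, j, h1, h2⟩ := exists_twist_zmod_of_nrm_eq_one x.a x.b x.c x.d
      ((hred hx h).trans Nat.cast_one)
    refine ⟨twist i j x, by rw [nrm_twist, hx], inDiagonal_of_reduce ?_ ?_⟩ <;>
      rwa [reduce_twist]
  · obtain ⟨x, hx, hn⟩ := exists_nrm_eq_not_normalizes hp h
    obtain ⟨i, j, h1, h2⟩ := exists_twist_zmod_of_nrm_eq_three x.a x.b x.c x.d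
      (hred hx h) (fun h => hn (normalizes_iff.2 h))
    refine ⟨twist i j x, by rw [nrm_twist, hx], inDiagonal_of_reduce ?_ ?_⟩ <;>
      rwa [reduce_twist]

lemma InDiagonal.exists_nrm_eq {x : QuatOrder ℤ} (hx : InDiagonal x) :
    ∃ a z b w : ℤ, a ^ 2 + 2 * z ^ 2 + 5 * b ^ 2 + 10 * w ^ 2 = nrm x := by
  obtain ⟨⟨w, hw⟩, ⟨b, hb⟩⟩ := hx
  refine ⟨x.a + b + 2 * w, -b + w - x.c, -b, w, ?_⟩
  simp only [nrm, hw, hb]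
  ring

end QuatOrder

/-- The form `a ^ 2 + 2 z ^ 2 + 5 b ^ 2 + 10 w ^ 2` is universal. -/
lemma exists_sq_add_two_sq_add_five_sq_add_ten_sq (n : ℕ) :
    ∃ a z b w : ℤ, a ^ 2 + 2 * z ^ 2 + 5 * b ^ 2 + 10 * w ^ 2 = n := by
  induction n using induction_on_primes with
  | zero => exact ⟨0, 0, 0, 0, by simp⟩
  | one => exact ⟨1, 0, 0, 0, by simp⟩
  | prime_mul p n hp ih =>
    obtain ⟨a', z', b', w', h'⟩ := ih
    obtain ⟨a, z, b, w, h⟩ : ∃ a z b w : ℤ, a ^ 2 + 2 * z ^ 2 + 5 * b ^ 2 + 10 * w ^ 2 = p := by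
      by_cases hp2 : p = 2
      · exact ⟨0, 1, 0, 0, by simp [hp2]⟩
      · obtain ⟨x, hx, hd⟩ := QuatOrder.exists_inDiagonal_of_prime hp hp2
        rw [← hx]
        exact hd.exists_nrm_eq
    refine ⟨a * a' - 2 * z * z' - 5 * b * b' - 10 * w * w',
      a * z' + z * a' + 5 * (b * w' - w * b'), a * b' + b * a' + 2 * (w * z' - z * w'),
      a * w' + w * a' + (z * b' - b * z'), ?_⟩
    push_cast
    rw [← h, ← h']
    ring

namespace QuatOrder

lemma exists_of_mod_four_eq_three {n : ℕ} (hn : n % 4 = 3) : ∃ x1 x2 y1 y2 : ℤ,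
    2 * x1 ^ 2 + 2 * x1 * x2 + 3 * x2 ^ 2 + 4 * y1 ^ 2 + 20 * y2 ^ 2 = n := by
  obtain ⟨x, hx⟩ := exists_nrm_eq n
  have hred : nrm (reduce x) = 3 := by
    rw [nrm_reduce, hx]
    exact_mod_cast (ZMod.natCast_eq_natCast_iff n 3 4).2 hn
  obtain ⟨i, j, hb, hd, ha⟩ := exists_twist_zmod_eq_two x.a x.b x.c x.d hred
  change (twist i j (reduce x)).b = 2 at hb
  change (twist i j (reduce x)).d = 0 at hd
  change 2 * (twist i j (reduce x)).a = 2 at ha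
  rw [← reduce_twist] at hb hd ha
  rw [← nrm_twist i j] at hx
  generalize twist i j x = y at hb hd ha hx
  obtain ⟨a, b, c, d⟩ := y
  obtain ⟨k, hk⟩ : (4 : ℤ) ∣ b - 2 := (ZMod.intCast_zmod_eq_zero_iff_dvd _ 4).1 (by
    push_cast; exact sub_eq_zero.2 hb)
  obtain ⟨m, rfl⟩ : (4 : ℤ) ∣ d := (ZMod.intCast_zmod_eq_zero_iff_dvd _ 4).1 hd
  obtain ⟨q, hq⟩ : (2 : ℤ) ∣ a - 1 := two_mul_intCast_eq_zero (by
    push_cast; rw [mul_sub, mul_one]; exact sub_eq_zero.2 ha)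
  obtain rfl : b = 4 * k + 2 := by linarith
  obtain rfl : a = 2 * q + 1 := by linarith
  refine ⟨-2 * m - c, 2 * k + 1, q + k + 1 + m, -m, ?_⟩
  rw [← hx]
  simp only [nrm]
  ring

end QuatOrder

theorem stmt_12 (n : ℤ) (hn : 0 ≤ n) :
    (∃ x1 x2 y1 y2 : ℤ, 2*x1^2 + 2*x1*x2 + 3*x2^2 + 4*y1^2 + 20*y2^2 = n) ↔
    (n % 2 = 0 ∨ n % 4 = 3) := by
  constructor
  · rintro ⟨x1, x2, y1, y2, rfl⟩
    have h1 : 2 * x1 ^ 2 + 2 * x1 * x2 = 2 * (x1 * (x1 + x2)) := by ring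
    rw [h1]
    rcases Int.even_or_odd' x2 with ⟨y, rfl | rfl⟩
    · left
      ring_nf
      omega
    · obtain ⟨r, hr⟩ | ⟨r, rfl⟩ := Int.even_or_odd x1
      · subst hr; right; ring_nf; omega
      · right; ring_nf; omega
  · lift n to ℕ using hn
    rintro (h | h)
    · obtain ⟨m, rfl⟩ : ∃ m, n = 2 * m := ⟨n / 2, by omega⟩
      obtain ⟨a, z, b, w, hm⟩ := exists_sq_add_two_sq_add_five_sq_add_ten_sq m
      refine ⟨a - b, 2 * b, z, w, ?_⟩
      push_cast
      rw [← hm]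
      ring
    · exact QuatOrder.exists_of_mod_four_eq_three (by omega)
end

section
/- A nonnegative integer n is represented by the quaternary quadratic form 2x₁² + 2x₁x₂ + 3x₂² + 5y₁² + 25y₂² if and only if n ≡ 0, 2 or 3 (mod 5). (This is the regularity of the binary Hermitian lattice [2, −1+ω; −1+ω̄, 3] ⊥ ⟨5⟩ over ℚ(√-5), stated for its associated quadratic form.) -/
/-- The reduced norm of `a + bω + (c + dω)e` in the maximal order of discriminant 5 with
`ω² + ω + 1 = 0`, `e² = -2` and `eω = 1 + ω²e`. -/
def nrm (a b c d : ℤ) : ℤ :=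
  a ^ 2 - a * b + b ^ 2 + 2 * (c ^ 2 - c * d + d ^ 2) - b * c + a * d

theorem nine_mul_nrm (a b c d : ℤ) :
    9 * nrm a b c d = ((3 * a - c + 2 * d) ^ 2 - (3 * a - c + 2 * d) * (3 * b - 2 * c + d)
      + (3 * b - 2 * c + d) ^ 2) + 15 * (c ^ 2 - c * d + d ^ 2) := by
  unfold nrm; ring

theorem hex_nonneg (x y : ℤ) : 0 ≤ x ^ 2 - x * y + y ^ 2 := by
  nlinarith [sq_nonneg (x - y), sq_nonneg x, sq_nonneg y]

theorem hex_eq_zero {x y : ℤ} (h : x ^ 2 - x * y + y ^ 2 = 0) : x = 0 ∧ y = 0 := by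
  constructor <;> rw [← sq_eq_zero_iff] <;>
    nlinarith [sq_nonneg (x - y), sq_nonneg x, sq_nonneg y]

theorem nrm_nonneg (a b c d : ℤ) : 0 ≤ nrm a b c d := by
  linarith [nine_mul_nrm a b c d, hex_nonneg (3 * a - c + 2 * d) (3 * b - 2 * c + d),
    hex_nonneg c d]

theorem nrm_eq_zero {a b c d : ℤ} (h : nrm a b c d = 0) : a = 0 ∧ b = 0 ∧ c = 0 ∧ d = 0 := by
  have h1 := nine_mul_nrm a b c d
  have h2 := hex_nonneg (3 * a - c + 2 * d) (3 * b - 2 * c + d)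
  have h3 := hex_nonneg c d
  obtain ⟨rfl, rfl⟩ := hex_eq_zero (x := c) (y := d) (by linarith)
  obtain ⟨h4, h5⟩ := hex_eq_zero
    (x := 3 * a - 0 + 2 * 0) (y := 3 * b - 2 * 0 + 0) (by linarith)
  omega

theorem acute_triangle {u v m : ℤ} (hu : 0 ≤ u) (hv : 0 ≤ v) (h1 : 2 * u + v ≤ m)
    (h2 : u + 2 * v ≤ m) : 3 * (u ^ 2 + u * v + v ^ 2) ≤ m ^ 2 := by
  have hle := sub_nonneg.mpr h1
  have hle₂ := sub_nonneg.mpr h2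
  linarith [mul_nonneg hle hle₂, mul_nonneg hu hle, mul_nonneg hu hle₂, mul_nonneg hv hle,
    mul_nonneg hv hle₂]

/-- The covering radius of the hexagonal lattice. -/
theorem exists_hex_le {m : ℤ} (hm : 0 < m) (x y : ℤ) :
    ∃ p q, 3 * ((x - m * p) ^ 2 - (x - m * p) * (y - m * q) + (y - m * q) ^ 2) ≤ m ^ 2 := by
  have bal : ∀ x : ℤ, ∃ p r, x = m * p + r ∧ 0 ≤ r ∧ r < m := fun x =>
    ⟨x / m, x % m, (Int.mul_ediv_add_emod x m).symm, Int.emod_nonneg x hm.ne',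
      Int.emod_lt_of_pos x hm⟩
  obtain ⟨p, r, rfl, hr0, hr1⟩ := bal x
  obtain ⟨q, s, rfl, hs0, hs1⟩ := bal y
  have key : ∀ i j : ℤ,
      3 * ((r - m * i) ^ 2 - (r - m * i) * (s - m * j) + (s - m * j) ^ 2) ≤ m ^ 2 →
      ∃ p' q', 3 * ((m * p + r - m * p') ^ 2 - (m * p + r - m * p') * (m * q + s - m * q')
        + (m * q + s - m * q') ^ 2) ≤ m ^ 2 := fun i j h =>
    ⟨p + i, q + j, by
      rw [show m * p + r - m * (p + i) = r - m * i by ring,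
        show m * q + s - m * (q + j) = s - m * j by ring]
      exact h⟩
  obtain hsr | hrs := le_total s r
  · rcases (by omega : (r - s ≤ m - r ∧ s ≤ m - r) ∨ (s ≤ r - s ∧ m - r ≤ r - s) ∨
      (r - s ≤ s ∧ m - r ≤ s)) with ⟨h1, h2⟩ | ⟨h1, h2⟩ | ⟨h1, h2⟩
    · have := acute_triangle (u := r - s) (v := s) (m := m) (by omega) (by omega) (by omega)
        (by omega)
      exact key 0 0 (by linarith)
    · have := acute_triangle (u := s) (v := m - r) (m := m) (by omega) (by omega) (by omega)
        (by omega)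
      exact key 1 0 (by linarith)
    · have := acute_triangle (u := r - s) (v := m - r) (m := m) (by omega) (by omega) (by omega)
        (by omega)
      exact key 1 1 (by linarith)
  · rcases (by omega : (s - r ≤ m - s ∧ r ≤ m - s) ∨ (r ≤ s - r ∧ m - s ≤ s - r) ∨
      (s - r ≤ r ∧ m - s ≤ r)) with ⟨h1, h2⟩ | ⟨h1, h2⟩ | ⟨h1, h2⟩
    · have := acute_triangle (u := s - r) (v := r) (m := m) (by omega) (by omega) (by omega)
        (by omega)
      exact key 0 0 (by linarith)
    · have := acute_triangle (u := r) (v := m - s) (m := m) (by omega) (by omega) (by omega)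
        (by omega)
      exact key 0 1 (by linarith)
    · have := acute_triangle (u := s - r) (v := m - s) (m := m) (by omega) (by omega) (by omega)
        (by omega)
      exact key 1 1 (by linarith)

/-- The maximal order is norm-Euclidean. -/
theorem exists_nrm_lt {m : ℤ} (hm : 0 < m) (a b c d : ℤ) :
    ∃ p q r s, nrm (a - m * p) (b - m * q) (c - m * r) (d - m * s) < m ^ 2 := by
  obtain ⟨r, s, h1⟩ := exists_hex_le hm c d
  obtain ⟨p, q, h2⟩ := exists_hex_le (show 0 < 3 * m by linarith)
    (3 * a - (c - m * r) + 2 * (d - m * s)) (3 * b - 2 * (c - m * r) + (d - m * s))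
  refine ⟨p, q, r, s, ?_⟩
  have h3 := nine_mul_nrm (a - m * p) (b - m * q) (c - m * r) (d - m * s)
  rw [show 3 * (a - m * p) - (c - m * r) + 2 * (d - m * s)
      = 3 * a - (c - m * r) + 2 * (d - m * s) - 3 * m * p by ring,
    show 3 * (b - m * q) - 2 * (c - m * r) + (d - m * s)
      = 3 * b - 2 * (c - m * r) + (d - m * s) - 3 * m * q by ring] at h3
  have h4 : 0 < m ^ 2 := by positivity
  linarith

theorem nrm_mul (a b c d p q r s : ℤ) :
    nrm (a * p - b * q + q * c - 2 * (c * (r - s) + d * s))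
      (a * q + b * p - b * q + q * d - 2 * (d * r - c * s))
      (a * r - b * s + c * (p - q) + d * q + s * c)
      (a * s + b * r - b * s + d * p - c * q + s * d) = nrm a b c d * nrm p q r s := by
  unfold nrm; ring

theorem nrm_smul (m a b c d : ℤ) :
    nrm (m * a) (m * b) (m * c) (m * d) = m ^ 2 * nrm a b c d := by
  unfold nrm; ring

/-- The quotient by `m` of the product of `v` with the conjugate of `v - m * t`. -/
theorem exists_nrm_mul {m k a b c d : ℤ} (hm : m ≠ 0) (h : nrm a b c d = m * k) (p q r s : ℤ) :
    ∃ j, nrm (a - m * p) (b - m * q) (c - m * r) (d - m * s) = m * j ∧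
      ∃ a' b' c' d', nrm a' b' c' d' = j * k := by
  obtain ⟨j, hj⟩ : ∃ j, nrm (a - m * p) (b - m * q) (c - m * r) (d - m * s) = m * j := by
    refine ⟨k + m * nrm p q r s - (2 * a * p - a * q - b * p + 2 * b * q
      + 2 * (2 * c * r - c * s - d * r + 2 * d * s) - b * r - c * q + a * s + d * p), ?_⟩
    rw [mul_sub, mul_add, ← h]
    unfold nrm; ring
  refine ⟨j, hj, k - (a * (p - q + s) - b * -q + -q * c - 2 * (c * (-r - -s) + d * -s)),
      -(a * -q + b * (p - q + s) - b * -q + -q * d - 2 * (d * -r - c * -s)),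
      -(a * -r - b * -s + c * ((p - q + s) - -q) + d * -q + -s * c),
      -(a * -s + b * -r - b * -s + d * (p - q + s) - c * -q + -s * d), ?_⟩
  have h1 := nrm_mul a b c d (a - m * p - (b - m * q) + (d - m * s)) (-(b - m * q))
    (-(c - m * r)) (-(d - m * s))
  have h2 : nrm (a - m * p - (b - m * q) + (d - m * s)) (-(b - m * q))
    (-(c - m * r)) (-(d - m * s)) = nrm (a - m * p) (b - m * q) (c - m * r) (d - m * s) := by
    unfold nrm; ring
  rw [h2, hj, h] at h1
  have hm2 : m ^ 2 ≠ 0 := pow_ne_zero 2 hm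
  apply mul_left_cancel₀ hm2
  rw [← nrm_smul, show m ^ 2 * (j * k) = m * k * (m * j) by ring, ← h1]
  congr 1
  · rw [mul_sub, ← h]; unfold nrm; ring
  · ring
  · ring
  · ring

theorem exists_nrm_eq_prime_of_mul {p : ℕ} (hp : p.Prime) (m : ℕ) :
    0 < m → m < p → (∃ a b c d, nrm a b c d = m * p) → ∃ a b c d, nrm a b c d = p := by
  induction m using Nat.strong_induction_on with
  | _ m ih =>
    rintro hm hmp ⟨a, b, c, d, h⟩
    obtain rfl | hm1 := eq_or_ne m 1
    · exact ⟨a, b, c, d, by simpa using h⟩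
    have hmz : (0 : ℤ) < m := by exact_mod_cast hm
    obtain ⟨x, y, z, w, hlt⟩ := exists_nrm_lt hmz a b c d
    obtain ⟨j, hj, hw⟩ := exists_nrm_mul hmz.ne' h x y z w
    have hn := nrm_nonneg (a - m * x) (b - m * y) (c - m * z) (d - m * w)
    rw [hj] at hlt hn
    have hj0 : 0 ≤ j := nonneg_of_mul_nonneg_right hn hmz
    have hjm : j < m := by nlinarith
    lift j to ℕ using hj0
    obtain rfl | hjpos := Nat.eq_zero_or_pos j
    · obtain ⟨h1, h2, h3, h4⟩ := nrm_eq_zero (hj.trans (by simp))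
      rw [sub_eq_zero.mp h1, sub_eq_zero.mp h2, sub_eq_zero.mp h3, sub_eq_zero.mp h4,
        nrm_smul, sq, mul_assoc] at h
      have hdvd : (m : ℤ) ∣ p := ⟨_, (mul_left_cancel₀ hmz.ne' h).symm⟩
      rcases (Nat.dvd_prime hp).mp (by exact_mod_cast hdvd) with h | h <;> omega
    · exact ih j (by exact_mod_cast hjm) hjpos (by omega) hw

theorem exists_sq_add_three_mul_sq {p : ℕ} [Fact p.Prime] (h2 : p ≠ 2) (h3 : p ≠ 3) :
    ∃ a s : ZMod p, a ^ 2 + 3 * s ^ 2 + 5 = 0 := by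
  have h3' : (3 : ZMod p) ≠ 0 := by
    intro h
    have : ((3 : ℕ) : ZMod p) = 0 := by exact_mod_cast h
    rw [ZMod.natCast_eq_zero_iff, Nat.prime_dvd_prime_iff_eq Fact.out Nat.prime_three] at this
    exact h3 this
  obtain ⟨a, s, h⟩ := FiniteField.exists_root_sum_quadratic
    (f := Polynomial.C (1 : ZMod p) * Polynomial.X ^ 2 + Polynomial.C 0 * Polynomial.X
      + Polynomial.C 0)
    (g := Polynomial.C (3 : ZMod p) * Polynomial.X ^ 2 + Polynomial.C 0 * Polynomial.X
      + Polynomial.C 5)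
    (Polynomial.degree_quadratic one_ne_zero) (Polynomial.degree_quadratic h3')
    (by rw [ZMod.card]; exact (Nat.Prime.eq_two_or_odd Fact.out).resolve_left h2)
  refine ⟨a, s, ?_⟩
  simp at h
  rw [← h]; ring

theorem exists_nrm_eq_prime {p : ℕ} (hp : p.Prime) : ∃ a b c d, nrm a b c d = p := by
  obtain rfl | h2 := eq_or_ne p 2
  · exact ⟨0, 0, 1, 0, rfl⟩
  obtain rfl | h3 := eq_or_ne p 3
  · exact ⟨1, 2, 0, 0, rfl⟩
  have : Fact p.Prime := ⟨hp⟩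
  obtain ⟨a, s, h⟩ := exists_sq_add_three_mul_sq h2 h3
  obtain ⟨a, rfl⟩ := ZMod.intCast_surjective a
  obtain ⟨s, rfl⟩ := ZMod.intCast_surjective s
  obtain ⟨k, hk⟩ : (p : ℤ) ∣ a ^ 2 + 3 * s ^ 2 + 5 := by
    rw [← ZMod.intCast_zmod_eq_zero_iff_dvd]
    push_cast
    exact h
  have h : nrm (a + s - 1) (2 * s) 1 2 = p * k := by rw [← hk]; unfold nrm; ring
  have hpz : (0 : ℤ) < p := by exact_mod_cast hp.pos
  obtain ⟨x, y, z, w, hlt⟩ := exists_nrm_lt hpz (a + s - 1) (2 * s) 1 2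
  obtain ⟨j, hj, -⟩ := exists_nrm_mul hpz.ne' h x y z w
  have hn := nrm_nonneg (a + s - 1 - p * x) (2 * s - p * y) (1 - p * z) (2 - p * w)
  have hn' : nrm (a + s - 1 - p * x) (2 * s - p * y) (1 - p * z) (2 - p * w) ≠ 0 := by
    intro h0
    have h1 : (p : ℤ) ∣ 1 := ⟨z, by linarith [(nrm_eq_zero h0).2.2.1]⟩
    have := Int.le_of_dvd one_pos h1
    have := hp.two_le
    omega
  rw [hj] at hlt hn hn'
  have hj0 : 0 ≤ j := nonneg_of_mul_nonneg_right hn hpz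
  have hjp : j < p := by nlinarith
  lift j to ℕ using hj0
  refine exists_nrm_eq_prime_of_mul hp j (Nat.pos_of_ne_zero ?_) (by exact_mod_cast hjp)
    ⟨_, _, _, _, hj.trans (mul_comm _ _)⟩
  rintro rfl
  simp at hn'

theorem exists_nrm_eq {n : ℤ} (hn : 0 ≤ n) : ∃ a b c d, nrm a b c d = n := by
  lift n to ℕ using hn
  induction n using Nat.recOnMul with
  | zero => exact ⟨0, 0, 0, 0, rfl⟩
  | one => exact ⟨1, 0, 0, 0, rfl⟩
  | prime p hp => exact exists_nrm_eq_prime hp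
  | mul m k hm hk =>
    obtain ⟨a, b, c, d, h⟩ := hm
    obtain ⟨p, q, r, s, h'⟩ := hk
    refine ⟨_, _, _, _, (nrm_mul a b c d p q r s).trans ?_⟩
    rw [h, h', Nat.cast_mul]

theorem nrm_omega_mul (a b c d : ℤ) : nrm (-b) (a - b) (-d) (c - d) = nrm a b c d := by
  unfold nrm; ring

theorem nrm_omega_sq_mul (a b c d : ℤ) : nrm (b - a) (-a) (d - c) (-c) = nrm a b c d := by
  unfold nrm; ring

theorem nrm_omega_mul_omega (a b c d : ℤ) :
    nrm (b - a - d) (c - a - d) c d = nrm a b c d := by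
  unfold nrm; ring

theorem nrm_omega_sq_mul_omega_sq (a b c d : ℤ) :
    nrm (c - b - d) (c + a - b) c d = nrm a b c d := by
  unfold nrm; ring

theorem nrm_omega_conj (a b c d : ℤ) :
    nrm (a + d) (b - c + d) (d - c) (-c) = nrm a b c d := by
  unfold nrm; ring

theorem nrm_omega_sq_conj (a b c d : ℤ) :
    nrm (a + d - c) (b - c) (-d) (c - d) = nrm a b c d := by
  unfold nrm; ring

theorem nrm_e_conj (a b c d : ℤ) :
    nrm (a - 2 * b + d) (-2 * b) (c - b - d) (-d) = nrm a (2 * b) c d := by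
  unfold nrm; ring

/-- The vectors with `b`, `d` and `2 * a - b + d` divisible by `2`, `2` and `5` form a copy of the
lattice in question. -/
theorem represented {a b c d n : ℤ} (h : nrm a b c d = n) (hb : b % 2 = 0) (hd : d % 2 = 0)
    (h5 : (2 * a - b + d) % 5 = 0) :
    ∃ x1 x2 y1 y2 : ℤ, 2*x1^2 + 2*x1*x2 + 3*x2^2 + 5*y1^2 + 25*y2^2 = n := by
  obtain ⟨x2, rfl⟩ : ∃ x2, b = 2 * x2 := ⟨b / 2, by omega⟩
  obtain ⟨y1, rfl⟩ : ∃ y1, d = 2 * y1 := ⟨d / 2, by omega⟩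
  obtain ⟨y2, hy⟩ : ∃ y2, a = x2 - y1 + 5 * y2 := ⟨(a - x2 + y1) / 5, by omega⟩
  refine ⟨y1 - c, x2, y1, y2, ?_⟩
  rw [← h, hy]; unfold nrm; ring

theorem nrm_emod_five (a b c d : ℤ) :
    nrm a b c d % 5 = ((a + 3 * c - d) ^ 2 - (a + 3 * c - d) * (b + c + 2 * d)
      + (b + c + 2 * d) ^ 2) % 5 := by
  rw [show (a + 3 * c - d) ^ 2 - (a + 3 * c - d) * (b + c + 2 * d) + (b + c + 2 * d) ^ 2
    = nrm a b c d + 5 * (c ^ 2 + d ^ 2 + a * c - a * d - c * d + b * d) by unfold nrm; ring,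
    Int.add_mul_emod_self_left]

theorem hex_emod_five (r s : ℤ) :
    ((r ^ 2 - r * s + s ^ 2) % 5 = 0 → r % 5 = 0 ∧ s % 5 = 0) ∧
    ((r ^ 2 - r * s + s ^ 2) % 5 = 2 ∨ (r ^ 2 - r * s + s ^ 2) % 5 = 3 →
      (2 * r - s) % 5 = 0 ∨ (2 * s - r) % 5 = 0 ∨ (r + s) % 5 = 0) ∧
    ((r ^ 2 - r * s + s ^ 2) % 5 = 1 ∨ (r ^ 2 - r * s + s ^ 2) % 5 = 4 →
      r % 5 = 0 ∨ s % 5 = 0 ∨ (r - s) % 5 = 0) := by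
  have hr : r % 5 = 0 ∨ r % 5 = 1 ∨ r % 5 = 2 ∨ r % 5 = 3 ∨ r % 5 = 4 := by omega
  have hs : s % 5 = 0 ∨ s % 5 = 1 ∨ s % 5 = 2 ∨ s % 5 = 3 ∨ s % 5 = 4 := by omega
  rcases hr with h | h | h | h | h <;> rcases hs with h' | h' | h' | h' | h' <;>
    simp [sq, Int.add_emod, Int.sub_emod, Int.mul_emod, h, h']

theorem exists_two_pow_mul (N : ℕ) (b c d : ℤ) (hN : b.natAbs + c.natAbs + d.natAbs ≤ N)
    (h : ¬ (b = 0 ∧ c = 0 ∧ d = 0)) :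
    ∃ (k : ℕ) (b' c' d' : ℤ), b = 2 ^ k * b' ∧ c = 2 ^ k * c' ∧ d = 2 ^ k * d' ∧
      ¬ (b' % 2 = 0 ∧ c' % 2 = 0 ∧ d' % 2 = 0) := by
  induction N generalizing b c d with
  | zero => omega
  | succ N ih =>
    by_cases he : b % 2 = 0 ∧ c % 2 = 0 ∧ d % 2 = 0
    · obtain ⟨k, b', c', d', hb, hc, hd, h'⟩ := ih (b / 2) (c / 2) (d / 2) (by omega) (by omega)
      refine ⟨k + 1, b', c', d', ?_, ?_, ?_, h'⟩ <;> rw [pow_succ', mul_assoc]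
      · rw [← hb]; omega
      · rw [← hc]; omega
      · rw [← hd]; omega
    · exact ⟨0, b, c, d, by simp, by simp, by simp, he⟩

/-- Conjugation by `ω` permutes the nonzero classes of the trace zero part modulo 2. -/
theorem of_omega_conj (m : ℤ) (P : ℤ → Prop) {a b c d : ℤ}
    (h : ¬ (b % 2 = 0 ∧ c % 2 = 0 ∧ d % 2 = 0))
    (key : ∀ a b c d, b % 2 = 1 → P (nrm a (m * b) (m * c) (m * d))) :
    P (nrm a (m * b) (m * c) (m * d)) := by
  rcases (by omega : b % 2 = 1 ∨ (b - c + d) % 2 = 1 ∨ (b - c) % 2 = 1) with hb | hb | hb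
  · exact key a b c d hb
  · rw [← nrm_omega_conj]
    convert key (a + m * d) (b - c + d) (d - c) (-c) hb using 2 <;> ring
  · rw [← nrm_omega_sq_conj]
    convert key (a + m * d - m * c) (b - c) (-d) (c - d) hb using 2 <;> ring

/-- Conjugation by elements of norm 2 moves a nonscalar element that is scalar modulo 2 to one
that is not in `ℤ[ω]` modulo 2. -/
theorem exists_nrm_eq_of_two_pow (k : ℕ) (a b c d : ℤ)
    (h : ¬ (b % 2 = 0 ∧ c % 2 = 0 ∧ d % 2 = 0)) :
    ∃ a' b' c' d', nrm a' b' c' d' =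
      nrm a (2 ^ (k + 1) * b) (2 ^ (k + 1) * c) (2 ^ (k + 1) * d) ∧
      ¬ (c' % 2 = 0 ∧ d' % 2 = 0) := by
  induction k generalizing a b c d with
  | zero =>
    exact of_omega_conj (2 ^ (0 + 1))
      (fun n => ∃ a' b' c' d', nrm a' b' c' d' = n ∧ ¬ (c' % 2 = 0 ∧ d' % 2 = 0)) h
      fun a b c d hb => ⟨_, _, _, _, by simpa using nrm_e_conj a b (2 * c) (2 * d), by omega⟩
  | succ k ih =>
    refine of_omega_conj (2 ^ (k + 1 + 1))
      (fun n => ∃ a' b' c' d', nrm a' b' c' d' = n ∧ ¬ (c' % 2 = 0 ∧ d' % 2 = 0)) h fun a b c d hb => ?_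
    obtain ⟨a', b', c', d', h1, h2⟩ := ih (a - 2 * (2 ^ (k + 1) * b) + 2 ^ (k + 2) * d) (-2 * b)
      (2 * c - b - 2 * d) (-2 * d) (by omega)
    refine ⟨a', b', c', d', ?_, h2⟩
    rw [h1, pow_succ _ (k + 1), mul_comm _ (2 : ℤ), mul_assoc 2, mul_assoc 2, mul_assoc 2,
      ← nrm_e_conj]
    congr 1 <;> ring

theorem emod_two_of_nrm_odd {a b c d : ℤ} (h : nrm a b c d % 2 = 1) (hc : c % 2 = 1)
    (hd : d % 2 = 0) : a % 2 = 1 ∧ b % 2 = 0 := by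
  rcases Int.emod_two_eq_zero_or_one a with ha | ha <;>
    rcases Int.emod_two_eq_zero_or_one b with hb | hb <;>
    simp [nrm, sq, Int.add_emod, Int.sub_emod, Int.mul_emod, ha, hb, hc, hd] at h ⊢

/-- An odd `n` that is not a square is the norm of an element that is congruent modulo 2 to a
fixed involution. -/
theorem exists_nrm_eq_involution {n : ℤ} (hn : 0 ≤ n) (hodd : n % 2 = 1)
    (hsq : ∀ k, n ≠ k ^ 2) :
    ∃ a b c d, nrm a b c d = n ∧ a % 2 = 1 ∧ b % 2 = 0 ∧ c % 2 = 1 ∧ d % 2 = 0 := by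
  obtain ⟨a, b, c, d, h, hcd⟩ : ∃ a b c d, nrm a b c d = n ∧ ¬ (c % 2 = 0 ∧ d % 2 = 0) := by
    have scalar (a b c d : ℤ) (h : nrm a b c d = n) (hb : b % 2 = 0) :
        ∃ a b c d, nrm a b c d = n ∧ ¬ (c % 2 = 0 ∧ d % 2 = 0) := by
      by_cases hcd : c % 2 = 0 ∧ d % 2 = 0
      · have h0 : ¬ (b / 2 = 0 ∧ c / 2 = 0 ∧ d / 2 = 0) := by
          rintro ⟨hb0, hc0, hd0⟩
          obtain ⟨rfl, rfl, rfl⟩ : b = 0 ∧ c = 0 ∧ d = 0 := by omega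
          exact hsq a (by rw [← h]; unfold nrm; ring)
        obtain ⟨k, b', c', d', hb', hc', hd', hne⟩ := exists_two_pow_mul _ _ _ _ le_rfl h0
        obtain ⟨a₁, b₁, c₁, d₁, h₁, h₂⟩ := exists_nrm_eq_of_two_pow k a b' c' d' hne
        refine ⟨a₁, b₁, c₁, d₁, ?_, h₂⟩
        rw [h₁, ← h, pow_succ', mul_assoc, mul_assoc, mul_assoc, ← hb', ← hc', ← hd']
        congr 1 <;> omega
      · exact ⟨a, b, c, d, h, hcd⟩
    obtain ⟨a, b, c, d, h⟩ := exists_nrm_eq hn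
    rcases (by omega : b % 2 = 0 ∨ (a - b) % 2 = 0 ∨ (-a) % 2 = 0) with hb | hb | hb
    · exact scalar _ _ _ _ h hb
    · exact scalar _ _ _ _ ((nrm_omega_mul a b c d).trans h) hb
    · exact scalar _ _ _ _ ((nrm_omega_sq_mul a b c d).trans h) hb
  have final (a b c d : ℤ) (h : nrm a b c d = n) (hc : c % 2 = 1) (hd : d % 2 = 0) :
      ∃ a b c d, nrm a b c d = n ∧ a % 2 = 1 ∧ b % 2 = 0 ∧ c % 2 = 1 ∧ d % 2 = 0 :=
    have hab := emod_two_of_nrm_odd (h ▸ hodd) hc hd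
    ⟨a, b, c, d, h, hab.1, hab.2, hc, hd⟩
  rcases (by omega : (c % 2 = 1 ∧ d % 2 = 0) ∨ ((d - c) % 2 = 1 ∧ (-c) % 2 = 0) ∨
    ((-d) % 2 = 1 ∧ (c - d) % 2 = 0)) with ⟨hc, hd⟩ | ⟨hc, hd⟩ | ⟨hc, hd⟩
  · exact final _ _ _ _ h hc hd
  · exact final _ _ _ _ ((nrm_omega_conj a b c d).trans h) hc hd
  · exact final _ _ _ _ ((nrm_omega_sq_conj a b c d).trans h) hc hd

theorem exists_nrm_eq_even {n : ℤ} (hn : 0 ≤ n) :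
    ∃ a b c d, nrm a b c d = n ∧ b % 2 = 0 ∧ d % 2 = 0 := by
  have of_even (a b c d : ℤ) (h : nrm a b c d = n) (hd : d % 2 = 0) :
      ∃ a b c d, nrm a b c d = n ∧ b % 2 = 0 ∧ d % 2 = 0 := by
    rcases (by omega : b % 2 = 0 ∨ (c - a - d) % 2 = 0 ∨ (c + a - b) % 2 = 0) with hb | hb | hb
    · exact ⟨_, _, _, _, h, hb, hd⟩
    · exact ⟨_, _, _, _, (nrm_omega_mul_omega a b c d).trans h, hb, hd⟩
    · exact ⟨_, _, _, _, (nrm_omega_sq_mul_omega_sq a b c d).trans h, hb, hd⟩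
  obtain ⟨a, b, c, d, h⟩ := exists_nrm_eq hn
  rcases (by omega : d % 2 = 0 ∨ (c - d) % 2 = 0 ∨ (-c) % 2 = 0) with hd | hd | hd
  · exact of_even _ _ _ _ h hd
  · exact of_even _ _ _ _ ((nrm_omega_mul a b c d).trans h) hd
  · exact of_even _ _ _ _ ((nrm_omega_sq_mul a b c d).trans h) hd

theorem represented_of_five_dvd {n : ℤ} (hn : 0 ≤ n) (h : n % 5 = 0) :
    ∃ x1 x2 y1 y2 : ℤ, 2*x1^2 + 2*x1*x2 + 3*x2^2 + 5*y1^2 + 25*y2^2 = n := by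
  obtain ⟨a, b, c, d, hv, hb, hd⟩ := exists_nrm_eq_even hn
  have hrs := (hex_emod_five (a + 3 * c - d) (b + c + 2 * d)).1
    (by rw [← nrm_emod_five, hv, h])
  exact represented hv hb hd (by omega)

theorem represented_of_odd {n : ℤ} (hn : 0 ≤ n) (hodd : n % 2 = 1)
    (h : n % 5 = 2 ∨ n % 5 = 3) :
    ∃ x1 x2 y1 y2 : ℤ, 2*x1^2 + 2*x1*x2 + 3*x2^2 + 5*y1^2 + 25*y2^2 = n := by
  have hsq : ∀ k, n ≠ k ^ 2 := by
    rintro k rfl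
    rcases (by omega : k % 5 = 0 ∨ k % 5 = 1 ∨ k % 5 = 2 ∨ k % 5 = 3 ∨ k % 5 = 4) with
      hk | hk | hk | hk | hk <;> simp [sq, Int.mul_emod, hk] at h
  obtain ⟨a, b, c, d, hv, ha, hb, hc, hd⟩ := exists_nrm_eq_involution hn hodd hsq
  rw [← hv, nrm_emod_five] at h
  rcases (hex_emod_five _ _).2.1 h with h5 | h5 | h5
  · exact represented hv hb hd (by omega)
  · exact represented ((nrm_omega_mul_omega a b c d).trans hv) (by omega) hd (by omega)
  · exact represented ((nrm_omega_sq_mul_omega_sq a b c d).trans hv) (by omega) hd (by omega)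

theorem represented_of_four_dvd {n : ℤ} (hn : 0 ≤ n) (h4 : n % 4 = 0)
    (h : n % 5 = 2 ∨ n % 5 = 3) :
    ∃ x1 x2 y1 y2 : ℤ, 2*x1^2 + 2*x1*x2 + 3*x2^2 + 5*y1^2 + 25*y2^2 = n := by
  obtain ⟨m, rfl⟩ : ∃ m, n = 2 ^ 2 * m := ⟨n / 4, by omega⟩
  have of_trace (a b c d : ℤ) (hv : nrm a b c d = m) (h5 : (2 * a - b + d) % 5 = 0) :
      ∃ x1 x2 y1 y2 : ℤ, 2*x1^2 + 2*x1*x2 + 3*x2^2 + 5*y1^2 + 25*y2^2 = 2 ^ 2 * m :=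
    represented (by rw [← hv, nrm_smul]) (Int.mul_emod_right 2 b) (Int.mul_emod_right 2 d)
      (by omega)
  obtain ⟨a, b, c, d, hv⟩ := exists_nrm_eq (n := m) (by omega)
  have hm : m % 5 = 2 ∨ m % 5 = 3 := by omega
  rw [← hv, nrm_emod_five] at hm
  rcases (hex_emod_five _ _).2.1 hm with h5 | h5 | h5
  · exact of_trace _ _ _ _ hv (by omega)
  · exact of_trace _ _ _ _ ((nrm_omega_sq_mul a b c d).trans hv) (by omega)
  · exact of_trace _ _ _ _ ((nrm_omega_mul a b c d).trans hv) (by omega)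

theorem represented_of_two_mul_odd {m : ℤ} (hm : 0 ≤ m) (hodd : m % 2 = 1)
    (h : m % 5 = 1 ∨ m % 5 = 4) :
    ∃ x1 x2 y1 y2 : ℤ, 2*x1^2 + 2*x1*x2 + 3*x2^2 + 5*y1^2 + 25*y2^2 = 2 * m := by
  by_cases hsq : ∃ k, m = k ^ 2
  · obtain ⟨k, rfl⟩ := hsq
    exact ⟨k, 0, 0, 0, by ring⟩
  obtain ⟨a, b, c, d, hv, ha, hb, hc, hd⟩ :=
    exists_nrm_eq_involution hm hodd fun k hk => hsq ⟨k, hk⟩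
  rw [← hv, nrm_emod_five] at h
  rcases (hex_emod_five _ _).2.2 h with h5 | h5 | h5
  · exact represented (a := d - a - c) (b := 2 * d) (c := b - c + d) (d := a - c + d)
      (by rw [← hv]; unfold nrm; ring) (by omega) (by omega) (by omega)
  · exact represented (a := b - 2 * c + 2 * d) (b := 2 * d) (c := a - b + d) (d := -b)
      (by rw [← hv]; unfold nrm; ring) (by omega) (by omega) (by omega)
  · exact represented (a := a - b - c + 2 * d) (b := 2 * d) (c := -a) (d := b - a - c)
      (by rw [← hv]; unfold nrm; ring) (by omega) (by omega) (by omega)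

theorem stmt_13 (n : ℤ) (hn : 0 ≤ n) :
    (∃ x1 x2 y1 y2 : ℤ, 2*x1^2 + 2*x1*x2 + 3*x2^2 + 5*y1^2 + 25*y2^2 = n) ↔
    (n % 5 = 0 ∨ n % 5 = 2 ∨ n % 5 = 3) := by
  constructor
  · rintro ⟨x1, x2, y1, y2, rfl⟩
    rw [show 2*x1^2 + 2*x1*x2 + 3*x2^2 + 5*y1^2 + 25*y2^2
      = 2 * (x1 + 3 * x2) ^ 2 + 5 * (y1 ^ 2 + 5 * y2 ^ 2 - 2 * x1 * x2 - 3 * x2 ^ 2) by ring,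
      Int.add_mul_emod_self_left]
    generalize x1 + 3 * x2 = t
    rcases (by omega : t % 5 = 0 ∨ t % 5 = 1 ∨ t % 5 = 2 ∨ t % 5 = 3 ∨ t % 5 = 4) with
      ht | ht | ht | ht | ht <;> simp [sq, Int.mul_emod, ht]
  · rintro (h | h)
    · exact represented_of_five_dvd hn h
    rcases (by omega : n % 2 = 1 ∨ n % 4 = 0 ∨ n % 4 = 2) with h2 | h2 | h2
    · exact represented_of_odd hn h2 h
    · exact represented_of_four_dvd hn h2 h
    · obtain ⟨m, rfl⟩ : ∃ m, n = 2 * m := ⟨n / 2, by omega⟩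
      exact represented_of_two_mul_odd (by omega) (by omega) (by omega)
end

section
/- A nonnegative integer n is represented by the quaternary quadratic form x₁² + 6x₂² + 3y₁² + 18y₂² if and only if n ≡ 0 or 1 (mod 3). (This is the regularity of the binary Hermitian lattice ⟨1,3⟩ over ℚ(√-6), stated for its associated quadratic form.) -/
theorem exists_sq_eq_sq_and_emod_three (a : ℤ) :
    ∃ b : ℤ, b ^ 2 = a ^ 2 ∧ (b % 3 = 0 ∨ b % 3 = 1) := by
  by_cases h : a % 3 = 2
  · exact ⟨-a, by ring, by omega⟩
  · exact ⟨a, rfl, by omega⟩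

/-- Four squares, three of whose roots have sum divisible by `3`. -/
theorem exists_four_squares_three_dvd_add (n : ℕ) :
    ∃ d a b c : ℤ, d ^ 2 + a ^ 2 + b ^ 2 + c ^ 2 = n ∧ 3 ∣ a + b + c := by
  obtain ⟨p, q, r, s, h⟩ := Nat.sum_four_squares n
  obtain ⟨a, ha, ha'⟩ := exists_sq_eq_sq_and_emod_three p
  obtain ⟨b, hb, hb'⟩ := exists_sq_eq_sq_and_emod_three q
  obtain ⟨c, hc, hc'⟩ := exists_sq_eq_sq_and_emod_three r
  obtain ⟨d, hd, hd'⟩ := exists_sq_eq_sq_and_emod_three s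
  have hsum : a ^ 2 + b ^ 2 + c ^ 2 + d ^ 2 = n := by
    rw [ha, hb, hc, hd]
    exact_mod_cast h
  have key : 3 ∣ b + c + d ∨ 3 ∣ b + c + -d ∨ 3 ∣ b + -c + d ∨
      3 ∣ a + c + d ∨ 3 ∣ a + c + -d ∨ 3 ∣ a + -c + d ∨
      3 ∣ a + b + d ∨ 3 ∣ a + -b + d ∨ 3 ∣ a + b + c := by
    omega
  rcases key with k | k | k | k | k | k | k | k | k
  exacts [⟨a, _, _, _, by linear_combination hsum, k⟩,
    ⟨a, _, _, _, by linear_combination hsum, k⟩,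
    ⟨a, _, _, _, by linear_combination hsum, k⟩,
    ⟨b, _, _, _, by linear_combination hsum, k⟩,
    ⟨b, _, _, _, by linear_combination hsum, k⟩,
    ⟨b, _, _, _, by linear_combination hsum, k⟩,
    ⟨c, _, _, _, by linear_combination hsum, k⟩,
    ⟨c, _, _, _, by linear_combination hsum, k⟩,
    ⟨d, _, _, _, by linear_combination hsum, k⟩]

/-- Every norm from `ℤ[ω]` is a norm from `ℤ[√-3]`. -/
theorem exists_sq_add_three_mul_sq_eq (u v : ℤ) :
    ∃ x y : ℤ, x ^ 2 + 3 * y ^ 2 = u ^ 2 + u * v + v ^ 2 := by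
  rcases Int.even_or_odd' v with ⟨w, rfl | rfl⟩
  · exact ⟨u + w, w, by ring⟩
  · rcases Int.even_or_odd' u with ⟨z, rfl | rfl⟩
    · exact ⟨2 * w + 1 + z, z, by ring⟩
    · exact ⟨z - w, z + w + 1, by ring⟩

/-- The quaternary form with diagonal coefficients `1, 3, 2, 6` is universal. -/
theorem exists_sq_add_three_mul_sq_add_two_mul_sq_add_six_mul_sq (n : ℕ) :
    ∃ d t x y : ℤ, d ^ 2 + 3 * t ^ 2 + 2 * x ^ 2 + 6 * y ^ 2 = n := by
  obtain ⟨d, a, b, c, h, t, ht⟩ := exists_four_squares_three_dvd_add n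
  obtain ⟨x, y, hxy⟩ := exists_sq_add_three_mul_sq_eq (a - t) (b - t)
  obtain rfl : c = 3 * t - a - b := by linarith
  exact ⟨d, t, x, y, by linear_combination h + 2 * hxy⟩

theorem sq_emod_three (x : ℤ) : x % 3 = 0 ∨ x ^ 2 % 3 = 1 := by
  have h : x % 3 = 0 ∨ x % 3 = 1 ∨ x % 3 = 2 := by omega
  rcases h with h | h | h <;> simp [pow_two, Int.mul_emod, h]

theorem stmt_15 (n : ℤ) (hn : 0 ≤ n) :
    (∃ x1 x2 y1 y2 : ℤ, x1^2 + 6*x2^2 + 3*y1^2 + 18*y2^2 = n) ↔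
    (n % 3 = 0 ∨ n % 3 = 1) := by
  constructor
  · rintro ⟨x1, x2, y1, y2, rfl⟩
    rcases sq_emod_three x1 with h | h
    · obtain ⟨k, rfl⟩ := Int.dvd_of_emod_eq_zero h
      left
      ring_nf
      omega
    · omega
  · rintro (h | h)
    · obtain ⟨m, rfl⟩ := Int.dvd_of_emod_eq_zero h
      lift m to ℕ using by omega
      obtain ⟨d, t, x, y, hm⟩ := exists_sq_add_three_mul_sq_add_two_mul_sq_add_six_mul_sq m
      exact ⟨3 * t, x, d, y, by linear_combination 3 * hm⟩
    · lift n to ℕ using hn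
      obtain ⟨d, t, x, y, hm⟩ := exists_sq_add_three_mul_sq_add_two_mul_sq_add_six_mul_sq n
      have hx : x % 3 = 0 := by
        rcases sq_emod_three x with hx | hx
        · exact hx
        · rcases sq_emod_three d with hd | hd
          · obtain ⟨k, rfl⟩ := Int.dvd_of_emod_eq_zero hd
            ring_nf at hm
            omega
          · omega
      obtain ⟨k, rfl⟩ := Int.dvd_of_emod_eq_zero hx
      exact ⟨d, y, t, k, by linear_combination hm⟩
end

section
/- A nonnegative integer n is represented by the quaternary quadratic form x₁² + x₁x₂ + 2x₂² + 7y₁² + 7y₁y₂ + 14y₂² if and only if n ≡ 0, 1, 2 or 4 (mod 7). (This is the regularity of the binary Hermitian lattice ⟨1,7⟩ over ℚ(√-7), stated for its associated quadratic form.) -/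
/-- The norm form of `ℤ[ω]`, `ω = (1 + √-7) / 2`, in the basis `1, ω`. -/
def normForm (x y : ℤ) : ℤ := x ^ 2 + x * y + 2 * y ^ 2

/-- The integer `n` is represented by the Hermitian lattice `⟨1, 1⟩`. -/
def IsSumOfTwoNorms (n : ℤ) : Prop :=
  ∃ x₁ x₂ y₁ y₂ : ℤ, normForm x₁ x₂ + normForm y₁ y₂ = n

/-- The integer `n` is represented by the Hermitian lattice `⟨1, 7⟩`. -/
def IsNormAddSevenNorm (n : ℤ) : Prop :=
  ∃ x₁ x₂ y₁ y₂ : ℤ, normForm x₁ x₂ + 7 * normForm y₁ y₂ = n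

/-- The values of the Hermitian form with Gram matrix `!![a, b; conj b, c]`, `b = b₁ + b₂ ω`. -/
def hermitianForm (a b₁ b₂ c u₁ u₂ v₁ v₂ : ℤ) : ℤ :=
  a * normForm u₁ u₂ + c * normForm v₁ v₂
    + 2 * (b₁ * u₁ - 2 * b₂ * u₂) * v₁ + (b₁ * u₁ - 2 * b₂ * u₂) * v₂
    + (b₁ * u₂ + b₂ * u₁ + b₂ * u₂) * v₁ + 4 * (b₁ * u₂ + b₂ * u₁ + b₂ * u₂) * v₂

theorem exists_abs_add_two_mul_mul_le {a : ℤ} (ha : 0 < a) (c : ℤ) :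
    ∃ t : ℤ, |c + 2 * a * t| ≤ a := by
  refine ⟨-((c + a) / (2 * a)), ?_⟩
  have h₁ := Int.emod_add_mul_ediv (c + a) (2 * a)
  have h₂ := Int.emod_nonneg (c + a) (show 2 * a ≠ 0 by omega)
  have h₃ := Int.emod_lt_of_pos (c + a) (show 0 < 2 * a by omega)
  rw [abs_le]
  constructor <;> linarith

theorem isSumOfTwoNorms_hermitianForm {a b₁ b₂ c : ℤ} (ha : 0 < a)
    (h : a * c = normForm b₁ b₂ + 1) (u₁ u₂ v₁ v₂ : ℤ) :
    IsSumOfTwoNorms (hermitianForm a b₁ b₂ c u₁ u₂ v₁ v₂) := by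
  obtain ⟨N, hN⟩ : ∃ N : ℕ, a ≤ N := ⟨a.toNat, by omega⟩
  induction N generalizing a b₁ b₂ c u₁ u₂ v₁ v₂ with
  | zero => simp at hN; omega
  | succ N ih =>
    obtain ⟨t₂, ht₂⟩ := exists_abs_add_two_mul_mul_le ha (2 * b₂)
    obtain ⟨t₁, ht₁⟩ := exists_abs_add_two_mul_mul_le ha (2 * b₁ + (b₂ + a * t₂))
    obtain ⟨d₁, hd₁⟩ : ∃ d, d = b₁ + a * t₁ := ⟨_, rfl⟩
    obtain ⟨d₂, hd₂⟩ : ∃ d, d = b₂ + a * t₂ := ⟨_, rfl⟩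
    obtain ⟨e, he⟩ : ∃ e, e = c + (2 * b₁ * t₁ + b₁ * t₂ + b₂ * t₁ + 4 * b₂ * t₂)
      + a * normForm t₁ t₂ := ⟨_, rfl⟩
    have hdet : a * e = normForm d₁ d₂ + 1 := by
      subst hd₁ hd₂ he
      unfold normForm at *
      linear_combination h
    have hshift : hermitianForm a b₁ b₂ c u₁ u₂ v₁ v₂ = hermitianForm a d₁ d₂ e
        (u₁ - ((t₁ + t₂) * v₁ + 2 * t₂ * v₂)) (u₂ - (t₁ * v₂ - t₂ * v₁)) v₁ v₂ := by
      subst hd₁ hd₂ he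
      unfold hermitianForm normForm
      ring
    rw [hshift]
    generalize u₁ - ((t₁ + t₂) * v₁ + 2 * t₂ * v₂) = u₁
    generalize u₂ - (t₁ * v₂ - t₂ * v₁) = u₂
    have hs₂ : (2 * d₂) ^ 2 ≤ a ^ 2 := by
      refine sq_le_sq' ?_ ?_ <;> rw [abs_le] at ht₂ <;> rw [hd₂] <;> linarith
    have hs₁ : (2 * d₁ + d₂) ^ 2 ≤ a ^ 2 := by
      refine sq_le_sq' ?_ ?_ <;> rw [abs_le] at ht₁ <;> rw [hd₂, hd₁] <;> linarith
    have hbound : 16 * (a * e) ≤ 11 * a ^ 2 + 16 := by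
      rw [hdet]; unfold normForm; linarith
    have hpos : 0 < a * e := by
      rw [hdet]; unfold normForm; nlinarith [sq_nonneg (2 * d₁ + d₂), sq_nonneg d₂]
    have he0 : 0 < e := pos_of_mul_pos_right hpos ha.le
    by_cases ha1 : a = 1
    · subst ha1
      have h2 : d₂ = 0 := Int.abs_lt_one_iff.1 ((sq_lt_one_iff_abs_lt_one d₂).1 (by linarith))
      subst h2
      have h1 : d₁ = 0 := Int.abs_lt_one_iff.1 ((sq_lt_one_iff_abs_lt_one d₁).1 (by linarith))
      subst h1
      refine ⟨u₁, u₂, v₁, v₂, ?_⟩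
      have : e = 1 := by simpa [normForm] using hdet
      subst this
      unfold hermitianForm
      ring
    · have hlt : e < a := by
        by_contra! hle
        have : 2 ≤ a := by omega
        nlinarith
      have hswap : hermitianForm a d₁ d₂ e u₁ u₂ v₁ v₂
          = hermitianForm e (d₁ + d₂) (-d₂) a v₁ v₂ u₁ u₂ := by
        unfold hermitianForm
        ring
      rw [hswap]
      refine ih he0 ?_ _ _ _ _ (by push_cast at hN; omega)
      unfold normForm at *
      linear_combination hdet

theorem exists_normForm_eq_of_discrim {a b c : ℤ} (ha : 0 < a) (h : 4 * a * c = b ^ 2 + 7)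
    (x y : ℤ) : ∃ u v : ℤ, normForm u v = a * x ^ 2 + b * x * y + c * y ^ 2 := by
  obtain ⟨N, hN⟩ : ∃ N : ℕ, a ≤ N := ⟨a.toNat, by omega⟩
  induction N generalizing a b c x y with
  | zero => simp at hN; omega
  | succ N ih =>
    obtain ⟨t, ht⟩ := exists_abs_add_two_mul_mul_le ha b
    obtain ⟨d, hd⟩ : ∃ d, d = b + 2 * a * t := ⟨_, rfl⟩
    obtain ⟨e, he⟩ : ∃ e, e = c + b * t + a * t ^ 2 := ⟨_, rfl⟩
    have hdet : 4 * a * e = d ^ 2 + 7 := by subst hd he; linear_combination h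
    have hshift : a * x ^ 2 + b * x * y + c * y ^ 2
        = a * (x - t * y) ^ 2 + d * (x - t * y) * y + e * y ^ 2 := by subst hd he; ring
    rw [hshift]
    generalize x - t * y = x
    rw [← hd, abs_le] at ht
    have hs : d ^ 2 ≤ a ^ 2 := sq_le_sq' ht.1 ht.2
    have he0 : 0 < e := by
      have : 0 < 4 * a * e := by rw [hdet]; positivity
      exact pos_of_mul_pos_right this (by omega)
    by_cases ha1 : a = 1
    · subst ha1
      obtain rfl | rfl : d = 1 ∨ d = -1 := by
        have : d ≠ 0 := by rintro rfl; omega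
        omega
      · obtain rfl : e = 2 := by omega
        exact ⟨x, y, by unfold normForm; ring⟩
      · obtain rfl : e = 2 := by omega
        exact ⟨x, -y, by unfold normForm; ring⟩
    · have hlt : e < a := by
        by_contra! hle
        have : 2 ≤ a := by omega
        nlinarith
      obtain ⟨u, v, huv⟩ := ih (c := a) (b := d) he0 (by linear_combination hdet) y x
        (by push_cast at hN; omega)
      exact ⟨u, v, by rw [huv]; ring⟩

theorem isSquare_neg_seven_of_mod_seven {p : ℕ} [Fact p.Prime] (hp2 : p ≠ 2)
    (h : p % 7 = 1 ∨ p % 7 = 2 ∨ p % 7 = 4) : IsSquare (-7 : ZMod p) := by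
  have hp7 : p ≠ 7 := by rintro rfl; omega
  have hres : (p : ZMod 7) ≠ 0 ∧ IsSquare (p : ZMod 7) := by
    have hmod : (p : ZMod 7) = ((p % 7 : ℕ) : ZMod 7) := by simp
    rw [hmod]
    rcases h with h | h | h <;> rw [h] <;> decide
  have : Fact (Nat.Prime 7) := ⟨by norm_num⟩
  have h7 : ((7 : ℕ) : ZMod p) ≠ 0 := by
    rw [Ne, ZMod.natCast_eq_zero_iff]
    exact fun hd => hp7 ((Nat.prime_dvd_prime_iff_eq Fact.out (by norm_num)).1 hd)
  have hpm : legendreSym 7 p = 1 :=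
    (legendreSym.eq_one_iff 7 (by simpa using hres.1)).2 (by simpa using hres.2)
  have hrec := legendreSym.quadratic_reciprocity' (p := 7) (q := p) (by norm_num) hp2
  have hneg : legendreSym p (-1 * 7) = 1 := by
    rw [legendreSym.mul, legendreSym.at_neg_one hp2, ZMod.χ₄_eq_neg_one_pow
      ((Nat.Prime.eq_two_or_odd Fact.out).resolve_left hp2)]
    push_cast at hrec
    rw [hrec, hpm, mul_one, ← pow_add]
    exact Even.neg_one_pow ⟨2 * (p / 2), by omega⟩
  have := (legendreSym.eq_one_iff p (a := -1 * 7) ?_).1 hneg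
  · simpa using this
  · push_cast at h7 ⊢
    simpa using h7

theorem exists_normForm_eq_prime {p : ℕ} (hp : p.Prime)
    (h : p % 7 = 1 ∨ p % 7 = 2 ∨ p % 7 = 4) : ∃ u v : ℤ, normForm u v = p := by
  by_cases hp2 : p = 2
  · exact ⟨0, 1, by subst hp2; rfl⟩
  have : Fact p.Prime := ⟨hp⟩
  obtain ⟨r, hr⟩ := isSquare_neg_seven_of_mod_seven hp2 h
  have hodd := (Nat.Prime.eq_two_or_odd hp).resolve_left hp2
  obtain ⟨b, hb, hbodd⟩ : ∃ b : ℤ, (b : ZMod p) = r ∧ b % 2 = 1 := by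
    obtain ⟨k, hk⟩ : ∃ k : ℤ, (k : ZMod p) = r := ⟨r.val, by simp⟩
    rcases Int.emod_two_eq_zero_or_one k with h0 | h1
    · exact ⟨k + p, by simpa using hk, by omega⟩
    · exact ⟨k, hk, h1⟩
  have hdvd : (p : ℤ) ∣ b ^ 2 + 7 := by
    rw [← ZMod.intCast_zmod_eq_zero_iff_dvd]
    push_cast
    rw [hb]
    linear_combination -hr
  have hdvd4 : (4 : ℤ) ∣ b ^ 2 + 7 := by
    obtain ⟨k, hk⟩ : ∃ k, b = 2 * k + 1 := ⟨b / 2, by omega⟩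
    exact ⟨k ^ 2 + k + 2, by rw [hk]; ring⟩
  have hcop : IsCoprime (4 : ℤ) p := by
    rw [show (4 : ℤ) = (4 : ℕ) by rfl, Nat.isCoprime_iff_coprime]
    exact (Nat.Coprime.pow_left 2 ((Nat.coprime_primes Nat.prime_two hp).2 (Ne.symm hp2)))
  obtain ⟨c, hc⟩ := hcop.mul_dvd hdvd4 hdvd
  obtain ⟨u, v, huv⟩ := exists_normForm_eq_of_discrim (a := p) (b := b) (c := c)
    (by exact_mod_cast hp.pos) hc.symm 1 0
  exact ⟨u, v, by rw [huv]; ring⟩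

theorem exists_dvd_normForm_add_one {p : ℕ} (hp : p.Prime) (hp2 : p ≠ 2) (hp7 : p ≠ 7) :
    ∃ u v : ℤ, (p : ℤ) ∣ normForm u v + 1 := by
  have : Fact p.Prime := ⟨hp⟩
  have h2 : (2 : ZMod p) ≠ 0 := by
    have : ((2 : ℕ) : ZMod p) ≠ 0 := by
      rw [Ne, ZMod.natCast_eq_zero_iff]
      exact fun hd => hp2 ((Nat.prime_dvd_prime_iff_eq hp Nat.prime_two).1 hd)
    exact_mod_cast this
  have h7 : (7 : ZMod p) ≠ 0 := by
    have : ((7 : ℕ) : ZMod p) ≠ 0 := by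
      rw [Ne, ZMod.natCast_eq_zero_iff]
      exact fun hd => hp7 ((Nat.prime_dvd_prime_iff_eq hp (by norm_num)).1 hd)
    exact_mod_cast this
  obtain ⟨s, y, hsy⟩ := FiniteField.exists_root_sum_quadratic (R := ZMod p)
    (f := Polynomial.C 1 * Polynomial.X ^ 2 + Polynomial.C 0 * Polynomial.X + Polynomial.C 4)
    (g := Polynomial.C 7 * Polynomial.X ^ 2 + Polynomial.C 0 * Polynomial.X + Polynomial.C 0)
    (Polynomial.degree_quadratic one_ne_zero) (Polynomial.degree_quadratic h7)
    (by rw [ZMod.card]; exact (Nat.Prime.eq_two_or_odd hp).resolve_left hp2)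
  simp at hsy
  refine ⟨((s - y) / 2 : ZMod p).val, y.val, ?_⟩
  rw [← ZMod.intCast_zmod_eq_zero_iff_dvd]
  unfold normForm
  push_cast
  rw [ZMod.natCast_zmod_val, ZMod.natCast_zmod_val]
  field_simp
  linear_combination hsy

theorem IsSumOfTwoNorms.mul {m n : ℤ} (hm : IsSumOfTwoNorms m) (hn : IsSumOfTwoNorms n) :
    IsSumOfTwoNorms (m * n) := by
  obtain ⟨x₁, x₂, y₁, y₂, rfl⟩ := hm
  obtain ⟨z₁, z₂, w₁, w₂, rfl⟩ := hn
  refine ⟨x₁ * z₁ - 2 * x₂ * z₂ - (y₁ * (w₁ + w₂) + 2 * y₂ * w₂),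
    x₁ * z₂ + x₂ * z₁ + x₂ * z₂ - (y₂ * w₁ - y₁ * w₂),
    x₁ * w₁ - 2 * x₂ * w₂ + (y₁ * (z₁ + z₂) + 2 * y₂ * z₂),
    x₁ * w₂ + x₂ * w₁ + x₂ * w₂ + (y₂ * z₁ - y₁ * z₂), ?_⟩
  unfold normForm
  ring

theorem isSumOfTwoNorms_prime {p : ℕ} (hp : p.Prime) : IsSumOfTwoNorms p := by
  by_cases hp2 : p = 2
  · exact ⟨0, 1, 0, 0, by subst hp2; rfl⟩
  by_cases hp7 : p = 7
  · exact ⟨-1, 2, 0, 0, by subst hp7; rfl⟩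
  obtain ⟨u, v, c, hc⟩ := exists_dvd_normForm_add_one hp hp2 hp7
  have := isSumOfTwoNorms_hermitianForm (a := p) (by exact_mod_cast hp.pos) hc.symm 1 0 0 0
  simpa [hermitianForm, normForm] using this

/-- The Hermitian lattice `⟨1, 1⟩` over `ℤ[ω]` is universal. -/
theorem isSumOfTwoNorms_natCast (n : ℕ) : IsSumOfTwoNorms n := by
  induction n using Nat.recOnMul with
  | zero => exact ⟨0, 0, 0, 0, rfl⟩
  | one => exact ⟨1, 0, 0, 0, rfl⟩
  | prime p hp => exact isSumOfTwoNorms_prime hp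
  | mul a b ha hb => push_cast; exact ha.mul hb

theorem exists_normForm_eq_seven_mul {x y : ℤ} (h : (x + 4 * y) % 7 = 0) :
    ∃ u v : ℤ, normForm x y = 7 * normForm u v := by
  obtain ⟨k, hk⟩ := Int.dvd_of_emod_eq_zero h
  obtain rfl : x = 7 * k - 4 * y := by omega
  exact ⟨k, y - 2 * k, by unfold normForm; ring⟩

theorem IsNormAddSevenNorm.normForm_mul {n : ℤ} (hn : IsNormAddSevenNorm n) (a b : ℤ) :
    IsNormAddSevenNorm (normForm a b * n) := by
  obtain ⟨x₁, x₂, y₁, y₂, rfl⟩ := hn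
  refine ⟨a * x₁ - 2 * b * x₂, a * x₂ + b * x₁ + b * x₂,
    a * y₁ - 2 * b * y₂, a * y₂ + b * y₁ + b * y₂, ?_⟩
  unfold normForm
  ring

theorem isNormAddSevenNorm_mul_of_dvd {x₁ x₂ y₁ y₂ z₁ z₂ w₁ w₂ : ℤ}
    (h : (7 : ℤ) ∣ (x₁ + 4 * x₂) * (w₁ + 4 * w₂) + (y₁ + 4 * y₂) * (z₁ + 4 * z₂)) :
    IsNormAddSevenNorm
      ((normForm x₁ x₂ + normForm y₁ y₂) * (normForm z₁ z₂ + normForm w₁ w₂)) := by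
  obtain ⟨k, hk⟩ := h
  obtain ⟨u, v, huv⟩ := exists_normForm_eq_seven_mul
    (x := x₁ * w₁ - 2 * x₂ * w₂ + (y₁ * (z₁ + z₂) + 2 * y₂ * z₂))
    (y := x₁ * w₂ + x₂ * w₁ + x₂ * w₂ + (y₂ * z₁ - y₁ * z₂))
    (Int.emod_eq_zero_of_dvd
      ⟨k - 2 * x₂ * w₂ - y₁ * z₂ - 2 * y₂ * z₂, by linear_combination hk⟩)
  refine ⟨x₁ * z₁ - 2 * x₂ * z₂ - (y₁ * (w₁ + w₂) + 2 * y₂ * w₂),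
    x₁ * z₂ + x₂ * z₁ + x₂ * z₂ - (y₂ * w₁ - y₁ * w₂), u, v, ?_⟩
  rw [← huv]
  unfold normForm
  ring

theorem normForm_neg (x y : ℤ) : normForm (-x) (-y) = normForm x y := by
  unfold normForm
  ring

theorem normForm_modEq (x y : ℤ) : normForm x y ≡ (x + 4 * y) ^ 2 [ZMOD 7] :=
  Int.modEq_iff_dvd.2 ⟨x * y + 2 * y ^ 2, by unfold normForm; ring⟩

theorem isNormAddSevenNorm_mul_of_nonresidue {m n : ℤ}
    (hm : m % 7 = 3 ∨ m % 7 = 5 ∨ m % 7 = 6) (hn : n % 7 = 3 ∨ n % 7 = 5 ∨ n % 7 = 6)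
    (hm' : IsSumOfTwoNorms m) (hn' : IsSumOfTwoNorms n) : IsNormAddSevenNorm (m * n) := by
  obtain ⟨x₁, x₂, y₁, y₂, rfl⟩ := hm'
  obtain ⟨z₁, z₂, w₁, w₂, rfl⟩ := hn'
  rw [((normForm_modEq x₁ x₂).add (normForm_modEq y₁ y₂)).eq] at hm
  rw [((normForm_modEq z₁ z₂).add (normForm_modEq w₁ w₂)).eq] at hn
  have key : ∀ x y z w : ZMod 7, (x ^ 2 + y ^ 2 = 3 ∨ x ^ 2 + y ^ 2 = 5 ∨ x ^ 2 + y ^ 2 = 6) →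
      (z ^ 2 + w ^ 2 = 3 ∨ z ^ 2 + w ^ 2 = 5 ∨ z ^ 2 + w ^ 2 = 6) →
      x * w + y * z = 0 ∨ x * -w + y * z = 0 ∨ x * z + y * w = 0 ∨ x * -z + y * w = 0 := by
    decide
  have cast : ∀ a b : ℤ, ((a ^ 2 + b ^ 2) % 7 = 3 ∨ (a ^ 2 + b ^ 2) % 7 = 5 ∨
      (a ^ 2 + b ^ 2) % 7 = 6) → ((a : ZMod 7) ^ 2 + b ^ 2 = 3 ∨ (a : ZMod 7) ^ 2 + b ^ 2 = 5 ∨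
      (a : ZMod 7) ^ 2 + b ^ 2 = 6) := by
    intro a b h
    have aux : ∀ c : ℤ, (a ^ 2 + b ^ 2) % 7 = c % 7 → (a : ZMod 7) ^ 2 + b ^ 2 = c := by
      intro c hc
      have := (ZMod.intCast_eq_intCast_iff _ _ 7).2 hc
      exact_mod_cast this
    exact h.imp (aux 3) (Or.imp (aux 5) (aux 6))
  have dvd : ∀ a b c d : ℤ, (a : ZMod 7) * b + c * d = 0 → (7 : ℤ) ∣ a * b + c * d := by
    intro a b c d h
    rw [← Nat.cast_ofNat, ← ZMod.intCast_zmod_eq_zero_iff_dvd]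
    exact_mod_cast h
  rcases key _ _ _ _ (cast _ _ hm) (cast _ _ hn) with h | h | h | h
  · exact isNormAddSevenNorm_mul_of_dvd (dvd _ _ _ _ h)
  · rw [← normForm_neg w₁ w₂]
    refine isNormAddSevenNorm_mul_of_dvd ?_
    convert dvd _ (-(w₁ + 4 * w₂)) _ _ (by exact_mod_cast h) using 2
    ring
  · rw [add_comm (normForm z₁ z₂)]
    exact isNormAddSevenNorm_mul_of_dvd (dvd _ _ _ _ h)
  · rw [add_comm (normForm z₁ z₂), ← normForm_neg z₁ z₂]
    refine isNormAddSevenNorm_mul_of_dvd ?_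
    convert dvd _ (-(z₁ + 4 * z₂)) _ _ (by exact_mod_cast h) using 2
    ring

theorem isNormAddSevenNorm_seven_mul {n : ℤ} (hn : IsSumOfTwoNorms n) :
    IsNormAddSevenNorm (7 * n) := by
  obtain ⟨x₁, x₂, y₁, y₂, rfl⟩ := hn
  exact ⟨7 * x₁ - 4 * (2 * x₁ + x₂), 2 * x₁ + x₂, y₁, y₂, by unfold normForm; ring⟩

theorem isNormAddSevenNorm_natCast_of_residue (n : ℕ)
    (h : n % 7 = 1 ∨ n % 7 = 2 ∨ n % 7 = 4) : IsNormAddSevenNorm n := by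
  induction n using Nat.strong_induction_on with
  | _ n ih =>
    by_cases h1 : n = 1
    · exact ⟨1, 0, 0, 0, by subst h1; rfl⟩
    obtain ⟨p, hp, m, rfl⟩ := Nat.exists_prime_and_dvd h1
    have hm0 : 0 < m := Nat.pos_of_ne_zero (by rintro rfl; simp at h)
    have hmul := Nat.mul_mod p m 7
    have hp7 := Nat.mod_lt p (show 7 > 0 by norm_num)
    have hm7 := Nat.mod_lt m (show 7 > 0 by norm_num)
    have hcases : ((p % 7 = 1 ∨ p % 7 = 2 ∨ p % 7 = 4) ∧ (m % 7 = 1 ∨ m % 7 = 2 ∨ m % 7 = 4)) ∨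
        ((p % 7 = 3 ∨ p % 7 = 5 ∨ p % 7 = 6) ∧ (m % 7 = 3 ∨ m % 7 = 5 ∨ m % 7 = 6)) := by
      rw [hmul] at h
      generalize p % 7 = r at *
      generalize m % 7 = s at *
      interval_cases r <;> interval_cases s <;> simp_all
    push_cast
    rcases hcases with ⟨hp', hm'⟩ | ⟨hp', hm'⟩
    · obtain ⟨u, v, huv⟩ := exists_normForm_eq_prime hp hp'
      rw [← huv]
      exact (ih m (lt_mul_left hm0 hp.one_lt) hm').normForm_mul u v
    · exact isNormAddSevenNorm_mul_of_nonresidue (by omega) (by omega)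
        (isSumOfTwoNorms_natCast p) (isSumOfTwoNorms_natCast m)

theorem stmt_16 (n : ℤ) (hn : 0 ≤ n) :
    (∃ x1 x2 y1 y2 : ℤ, x1^2 + x1*x2 + 2*x2^2 + 7*y1^2 + 7*y1*y2 + 14*y2^2 = n) ↔
    (n % 7 = 0 ∨ n % 7 = 1 ∨ n % 7 = 2 ∨ n % 7 = 4) := by
  constructor
  · rintro ⟨x1, x2, y1, y2, rfl⟩
    have hmod : x1^2 + x1*x2 + 2*x2^2 + 7*y1^2 + 7*y1*y2 + 14*y2^2
        ≡ (x1 + 4 * x2) ^ 2 [ZMOD 7] :=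
      Int.modEq_iff_dvd.2 ⟨x1 * x2 + 2 * x2 ^ 2 - y1 ^ 2 - y1 * y2 - 2 * y2 ^ 2, by ring⟩
    rw [hmod.eq, sq, Int.mul_emod]
    have h0 := Int.emod_nonneg (x1 + 4 * x2) (show (7 : ℤ) ≠ 0 by norm_num)
    have h7 := Int.emod_lt_of_pos (x1 + 4 * x2) (show (0 : ℤ) < 7 by norm_num)
    generalize (x1 + 4 * x2) % 7 = r at *
    interval_cases r <;> simp
  · intro h
    lift n to ℕ using hn
    obtain ⟨x1, x2, y1, y2, hxy⟩ : IsNormAddSevenNorm n := by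
      rcases h with h | h
      · obtain ⟨m, rfl⟩ : 7 ∣ n := by omega
        push_cast
        exact isNormAddSevenNorm_seven_mul (isSumOfTwoNorms_natCast m)
      · exact isNormAddSevenNorm_natCast_of_residue n (by omega)
    exact ⟨x1, x2, y1, y2, by rw [← hxy]; unfold normForm; ring⟩
end
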